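/- arXiv:2410.22336 — 8 statements merged into one kernel-verified Lean document; each statement's English description precedes it below -/
import Mathlib

section
/- Let t ≥ 1 and fix a ∈ [0,1]. Suppose the projected subgradient method is run with the step-size family η_s = R/(G_s · s^{a/2}) for s = 1,…,t, where G_s = max_{1≤j≤s} ‖g_j‖ · j^{(1−a)/2} (and each g_s ≠ 0). Then f((1/t)·Σ_{s=1}^t x_s) − f(x*) ≤ (3R/(2√t)) · max_{s=1,…,t} ‖g_s‖. -/
open scoped RealInnerProductSpace

/-- Projecting onto a convex set does not increase the distance to points of the set. -/
theorem norm_sub_le_of_forall_norm_sub_le {E : Type*} [NormedAddCommGroup E]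
    [InnerProductSpace ℝ E] {X : Set E} (hX : Convex ℝ X) {p y w : E} (hp : p ∈ X)
    (hproj : ∀ z ∈ X, ‖p - y‖ ≤ ‖z - y‖) (hw : w ∈ X) : ‖p - w‖ ≤ ‖y - w‖ := by
  have hinf : ‖y - p‖ = ⨅ z : X, ‖y - z‖ := by
    have : Nonempty X := ⟨⟨p, hp⟩⟩
    refine le_antisymm (le_ciInf fun z => ?_) ?_
    · rw [norm_sub_rev y p, norm_sub_rev y z]
      exact hproj z z.2
    · exact ciInf_le ⟨0, by rintro _ ⟨z, rfl⟩; exact norm_nonneg _⟩ (⟨p, hp⟩ : X)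
  have hinner := (norm_eq_iInf_iff_real_inner_le_zero hX hp).1 hinf w hw
  have hexp : ‖y - w‖ ^ 2 = ‖y - p‖ ^ 2 - 2 * ⟪y - p, w - p⟫ + ‖p - w‖ ^ 2 := by
    rw [norm_sub_rev p w, ← norm_sub_sq_real]
    congr 2
    abel
  refine le_of_sq_le_sq ?_ (norm_nonneg _)
  nlinarith [sq_nonneg ‖y - p‖]

/-- The one-step inequality of the projected subgradient method. -/
theorem inner_sub_le_of_projected_step {E : Type*} [NormedAddCommGroup E]
    [InnerProductSpace ℝ E] {x x' g w : E} {η : ℝ} (hη : 0 < η)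
    (h : ‖x' - w‖ ≤ ‖x - η • g - w‖) :
    ⟪g, x - w⟫ ≤ (‖x - w‖ ^ 2 - ‖x' - w‖ ^ 2) * (1 / (2 * η)) + η * ‖g‖ ^ 2 / 2 := by
  have hsq : ‖x' - w‖ ^ 2 ≤ ‖x - η • g - w‖ ^ 2 := by gcongr
  rw [sub_right_comm, norm_sub_sq_real (x - w), real_inner_smul_right, norm_smul, Real.norm_eq_abs,
    abs_of_pos hη, real_inner_comm] at hsq
  rw [← sub_nonneg]
  have : (‖x - w‖ ^ 2 - ‖x' - w‖ ^ 2) * (1 / (2 * η)) + η * ‖g‖ ^ 2 / 2 - ⟪g, x - w⟫ =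
      (‖x - w‖ ^ 2 - 2 * (η * ⟪g, x - w⟫) + (η * ‖g‖) ^ 2 - ‖x' - w‖ ^ 2) / (2 * η) := by
    field_simp
    ring
  rw [this]
  exact div_nonneg (by linarith) (by positivity)

theorem one_div_two_mul_sqrt_le_sub (k : ℕ) :
    1 / (2 * √((k : ℝ) + 1)) ≤ √((k : ℝ) + 1) - √k := by
  have hpos : 0 < √((k : ℝ) + 1) := Real.sqrt_pos.2 (by positivity)
  have h₁ := Real.sq_sqrt (show (0 : ℝ) ≤ (k : ℝ) + 1 by positivity)
  have h₂ := Real.sq_sqrt (show (0 : ℝ) ≤ (k : ℝ) by positivity)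
  rw [div_le_iff₀ (by positivity)]
  nlinarith [sq_nonneg (√((k : ℝ) + 1) - √k)]

/-- Weighted telescoping: nondecreasing weights `c` against squared distances bounded by `B`,
plus error terms of order `1 / √s`. -/
theorem sum_Icc_le_of_telescoping {δ c d : ℕ → ℝ} {B C : ℝ} {t : ℕ} (hC : 0 ≤ C)
    (hd : ∀ s, 1 ≤ s → d s ≤ B) (hc : ∀ s, 1 ≤ s → s ≤ t → 0 ≤ c s)
    (hmono : ∀ s, 1 ≤ s → s + 1 ≤ t → c s ≤ c (s + 1))
    (hδ : ∀ s, 1 ≤ s → s ≤ t → δ s ≤ (d s - d (s + 1)) * c s + C * (1 / (2 * √s)))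
    (ht : 1 ≤ t) :
    ∑ s ∈ Finset.Icc 1 t, δ s ≤ (B - d (t + 1)) * c t + C * √t := by
  have key : ∀ k, 1 ≤ k → k ≤ t →
      ∑ s ∈ Finset.Icc 1 k, δ s ≤ (B - d (k + 1)) * c k + C * √k := by
    intro k hk
    induction k, hk using Nat.le_induction with
    | base =>
      intro h
      have h₁ := hδ 1 le_rfl h
      have h₂ := mul_le_mul_of_nonneg_right (hd 1 le_rfl) (hc 1 le_rfl h)
      simp only [Finset.Icc_self, Finset.sum_singleton, Nat.cast_one, Real.sqrt_one] at h₁ ⊢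
      linarith
    | succ k hk ih =>
      intro h
      rw [Finset.sum_Icc_succ_top (by omega)]
      have h₁ := ih (by omega)
      have h₂ := hδ (k + 1) (by omega) h
      have h₃ := mul_le_mul_of_nonneg_left (hmono k hk h)
        (sub_nonneg.2 (hd (k + 1) (by omega)))
      have h₄ := mul_le_mul_of_nonneg_left (one_div_two_mul_sqrt_le_sub k) hC
      push_cast at h₂ ⊢
      linarith
  exact key t ht le_rfl

theorem rpow_half_mul_rpow_half {s : ℝ} (hs : 0 < s) (a : ℝ) :
    s ^ ((1 - a) / 2) * s ^ (a / 2) = √s := by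
  rw [← Real.rpow_add hs, Real.sqrt_eq_rpow]
  congr 1
  ring

theorem stmt0 {n : ℕ} (X : Set (EuclideanSpace ℝ (Fin n)))
    (hXne : X.Nonempty) (hXcl : IsClosed X) (hXcv : Convex ℝ X)
    (R : ℝ) (hR : 0 < R)
    (xstar : EuclideanSpace ℝ (Fin n)) (hxstar : xstar ∈ X)
    (f : EuclideanSpace ℝ (Fin n) → ℝ) (hf : ConvexOn ℝ Set.univ f)
    (hball : X ⊆ Metric.closedBall xstar R)
    (hmin : ∀ z ∈ X, f xstar ≤ f z)
    (x g : ℕ → EuclideanSpace ℝ (Fin n)) (η : ℕ → ℝ)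
    (hx1 : x 1 ∈ X)
    (hηpos : ∀ s, 1 ≤ s → 0 < η s)
    (hsub : ∀ s, 1 ≤ s → ∀ z, f (x s) + ⟪g s, z - x s⟫ ≤ f z)
    (hmem : ∀ s, 1 ≤ s → x (s + 1) ∈ X)
    (hproj : ∀ s, 1 ≤ s → ∀ z ∈ X,
      ‖x (s + 1) - (x s - η s • g s)‖ ≤ ‖z - (x s - η s • g s)‖)
    (a : ℝ) (ha : a ∈ Set.Icc (0 : ℝ) 1)
    (t : ℕ) (ht : 1 ≤ t)
    (hgne : ∀ s, 1 ≤ s → s ≤ t → g s ≠ 0)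
    (G : ℕ → ℝ)
    (hG : ∀ s (hs : 1 ≤ s), G s =
      (Finset.Icc 1 s).sup' (Finset.nonempty_Icc.mpr hs)
        (fun j => ‖g j‖ * (j : ℝ) ^ ((1 - a) / 2)))
    (hη : ∀ s, 1 ≤ s → s ≤ t → η s = R / (G s * (s : ℝ) ^ (a / 2)))
    :
    f ((1 / (t : ℝ)) • ∑ s ∈ Finset.Icc 1 t, x s) - f xstar ≤
      3 * R / (2 * Real.sqrt t) *
        ((Finset.Icc 1 t).sup' (Finset.nonempty_Icc.mpr ht) fun s => ‖g s‖) := by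
  set M := (Finset.Icc 1 t).sup' (Finset.nonempty_Icc.mpr ht) fun s => ‖g s‖ with hM
  have hgM : ∀ s, 1 ≤ s → s ≤ t → ‖g s‖ ≤ M := fun s h₁ h₂ =>
    Finset.le_sup' (fun s => ‖g s‖) (Finset.mem_Icc.2 ⟨h₁, h₂⟩)
  have hM0 : 0 ≤ M := (norm_nonneg _).trans (hgM 1 le_rfl ht)
  have hgG : ∀ s, 1 ≤ s → ‖g s‖ * (s : ℝ) ^ ((1 - a) / 2) ≤ G s := fun s hs => by
    rw [hG s hs]
    exact Finset.le_sup' (fun j : ℕ => ‖g j‖ * (j : ℝ) ^ ((1 - a) / 2))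
      (Finset.mem_Icc.2 ⟨hs, le_rfl⟩)
  have hGmono : ∀ s, 1 ≤ s → G s ≤ G (s + 1) := fun s hs => by
    rw [hG s hs, hG (s + 1) (by omega)]
    exact Finset.sup'_mono _ (Finset.Icc_subset_Icc_right (by omega)) _
  have hcast : ∀ s : ℕ, 1 ≤ s → (0 : ℝ) < s := fun s hs => by exact_mod_cast hs
  have hGpos : ∀ s, 1 ≤ s → s ≤ t → 0 < G s := fun s hs hst =>
    (mul_pos (norm_pos_iff.2 (hgne s hs hst)) (Real.rpow_pos_of_pos (hcast s hs) _)).trans_le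
      (hgG s hs)
  have hGt : G t ≤ M * (t : ℝ) ^ ((1 - a) / 2) := by
    rw [hG t ht]
    refine Finset.sup'_le _ _ fun j hj => ?_
    obtain ⟨h₁, h₂⟩ := Finset.mem_Icc.1 hj
    have hexp : 0 ≤ (1 - a) / 2 := by linarith [ha.2]
    have := hgM j h₁ h₂
    gcongr
  have hdist : ∀ s, 1 ≤ s → ‖x s - xstar‖ ^ 2 ≤ R ^ 2 := fun s hs => by
    have hxs : x s ∈ X := by
      obtain rfl | h := hs.eq_or_lt
      · exact hx1
      · obtain ⟨k, rfl⟩ := Nat.exists_eq_add_of_lt h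
        exact hmem (1 + k) (by omega)
    have := mem_closedBall_iff_norm.1 (hball hxs)
    gcongr
  have hinv : ∀ s, 1 ≤ s → s ≤ t → 1 / (2 * η s) = G s * (s : ℝ) ^ (a / 2) / (2 * R) :=
    fun s hs hst => by
      have := hGpos s hs hst
      have := Real.rpow_pos_of_pos (hcast s hs) (a / 2)
      rw [hη s hs hst]
      field_simp
  have hsum := sum_Icc_le_of_telescoping (δ := fun s => f (x s) - f xstar)
    (c := fun s => 1 / (2 * η s)) (d := fun s => ‖x s - xstar‖ ^ 2) (B := R ^ 2)
    (C := R * M) (t := t) (by positivity) hdist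
    (fun s hs _ => by have := hηpos s hs; positivity)
    (fun s hs hst => by
      rw [hinv s hs (by omega), hinv (s + 1) (by omega) hst]
      have h₁ := hGmono s hs
      have h₂ := hGpos (s + 1) (by omega) hst
      have h₃ : 0 ≤ a / 2 := by linarith [ha.1]
      have h₄ : (s : ℝ) ≤ ((s + 1 : ℕ) : ℝ) := by push_cast; linarith
      gcongr)
    (fun s hs hst => by
      have h₁ := hsub s hs xstar
      have h₂ := inner_sub_le_of_projected_step (hηpos s hs)
        (norm_sub_le_of_forall_norm_sub_le hXcv (hmem s hs) (hproj s hs) hxstar)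
      have h₃ : η s * ‖g s‖ ^ 2 / 2 ≤ R * M * (1 / (2 * √s)) := by
        have hs0 := Real.sqrt_pos.2 (hcast s hs)
        have hp := Real.rpow_pos_of_pos (hcast s hs) (a / 2)
        have hGs := hGpos s hs hst
        have hle : ‖g s‖ * √s ≤ G s * (s : ℝ) ^ (a / 2) := by
          rw [← rpow_half_mul_rpow_half (hcast s hs) a, ← mul_assoc]
          exact mul_le_mul_of_nonneg_right (hgG s hs) hp.le
        have hηle : η s * (‖g s‖ * √s) ≤ R := by
          rw [hη s hs hst, div_mul_eq_mul_div, div_le_iff₀ (by positivity)]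
          gcongr
        have hgs := hgM s hs hst
        have : η s * ‖g s‖ ^ 2 * √s ≤ R * M := by
          calc η s * ‖g s‖ ^ 2 * √s = η s * (‖g s‖ * √s) * ‖g s‖ := by ring
            _ ≤ R * M := by gcongr
        rw [mul_one_div, div_le_div_iff₀ two_pos (by positivity)]
        linarith
      rw [← neg_sub (x s) xstar, inner_neg_right] at h₁
      linarith)
    ht
  have ht0 := hcast t ht
  have hlast : (R ^ 2 - ‖x (t + 1) - xstar‖ ^ 2) * (1 / (2 * η t)) ≤ R * M * √t / 2 := by
    have hηt := hηpos t ht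
    have hp := Real.rpow_pos_of_pos ht0 (a / 2)
    calc (R ^ 2 - ‖x (t + 1) - xstar‖ ^ 2) * (1 / (2 * η t))
        ≤ R ^ 2 * (1 / (2 * η t)) := by
          gcongr
          linarith [sq_nonneg ‖x (t + 1) - xstar‖]
      _ = R * (G t * (t : ℝ) ^ (a / 2)) / 2 := by
          rw [hinv t ht le_rfl]
          field_simp
      _ ≤ R * (M * (t : ℝ) ^ ((1 - a) / 2) * (t : ℝ) ^ (a / 2)) / 2 := by gcongr
      _ = R * M * √t / 2 := by
          rw [mul_assoc M, rpow_half_mul_rpow_half ht0]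
          ring
  have hjensen : f ((1 / (t : ℝ)) • ∑ s ∈ Finset.Icc 1 t, x s) ≤
      (1 / (t : ℝ)) * ∑ s ∈ Finset.Icc 1 t, f (x s) := by
    rw [Finset.smul_sum, Finset.mul_sum]
    refine hf.map_sum_le (fun _ _ => by positivity) ?_ (fun _ _ => Set.mem_univ _)
    simp [ht0.ne']
  rw [Finset.sum_sub_distrib, Finset.sum_const, Nat.card_Icc, Nat.add_sub_cancel,
    nsmul_eq_mul] at hsum
  have hst := Real.sqrt_pos.2 ht0
  calc f ((1 / (t : ℝ)) • ∑ s ∈ Finset.Icc 1 t, x s) - f xstar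
      ≤ (1 / (t : ℝ)) * ∑ s ∈ Finset.Icc 1 t, f (x s) - f xstar := by gcongr
    _ = (1 / (t : ℝ)) * (∑ s ∈ Finset.Icc 1 t, f (x s) - t * f xstar) := by field_simp
    _ ≤ (1 / (t : ℝ)) * (3 / 2 * R * M * √t) := by
        gcongr
        linarith
    _ = 3 * R / (2 * √t) * M := by
        rw [← Real.sq_sqrt ht0.le, Real.sqrt_sq hst.le]
        field_simp
end

section
/- Let t ≥ 1, fix a ∈ [0,1] and k with −1 ≤ k ≤ 0. Suppose the projected subgradient method is run with η_s = R/(G_s · s^{a/2}), G_s = max_{1≤j≤s} ‖g_j‖ · j^{(1−a)/2} (each g_s ≠ 0), and set weights w_s = η_s^{−k}. Then f((Σ_{s=1}^t w_s x_s)/(Σ_{s=1}^t w_s)) − f(x*) ≤ [(t^{(k+1)/2} + Σ_{s=1}^t s^{(k−1)/2}) / (2 Σ_{s=1}^t s^{k/2})] · R · max_{s=1,…,t} ‖g_s‖. -/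
open scoped RealInnerProductSpace

/-- Summation by parts for a nonnegative monotone weight `b` against the decrements of a bounded
sequence `d`. -/
theorem sum_Icc_mul_sub_succ_le (b d : ℕ → ℝ) (D : ℝ) (t : ℕ) (ht : 1 ≤ t)
    (hb0 : ∀ s, 1 ≤ s → s ≤ t → 0 ≤ b s)
    (hb : ∀ s, 1 ≤ s → s + 1 ≤ t → b s ≤ b (s + 1))
    (hd : ∀ s, 1 ≤ s → d s ≤ D) :
    ∑ s ∈ Finset.Icc 1 t, b s * (d s - d (s + 1)) ≤ b t * (D - d (t + 1)) := by
  induction t, ht using Nat.le_induction with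
  | base =>
    simpa using mul_le_mul_of_nonneg_left (sub_le_sub_right (hd 1 le_rfl) (d 2))
      (hb0 1 le_rfl le_rfl)
  | succ m hm ih =>
    rw [Finset.sum_Icc_succ_top (by omega)]
    have ih' := ih (fun s h h' => hb0 s h (by omega)) (fun s h h' => hb s h (by omega))
    have hmono := mul_le_mul_of_nonneg_right (hb m hm le_rfl)
      (sub_nonneg.2 (hd (m + 1) (by omega)))
    linarith

/-- A nearest point `v` of a convex set to `u` is at least as close as `u` to every point of the
set. -/
theorem norm_sub_le_of_forall_norm_sub_le_s1 {E : Type*} [NormedAddCommGroup E]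
    [InnerProductSpace ℝ E] {K : Set E} (hK : Convex ℝ K) {u v z : E} (hv : v ∈ K) (hz : z ∈ K)
    (hproj : ∀ z ∈ K, ‖v - u‖ ≤ ‖z - u‖) : ‖v - z‖ ≤ ‖u - z‖ := by
  have : Nonempty K := ⟨⟨v, hv⟩⟩
  have hinf : ‖u - v‖ = ⨅ w : K, ‖u - w‖ := by
    refine le_antisymm (le_ciInf fun w => ?_) ?_
    · rw [norm_sub_rev u v, norm_sub_rev u w]
      exact hproj w w.2
    · exact ciInf_le (f := fun w : K => ‖u - w‖)
        ⟨0, by rintro _ ⟨w, rfl⟩; exact norm_nonneg _⟩ ⟨v, hv⟩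
  have hinner := (norm_eq_iInf_iff_real_inner_le_zero hK hv).1 hinf z hz
  have hsq : ‖u - z‖ ^ 2 = ‖u - v‖ ^ 2 - 2 * ⟪u - v, z - v⟫ + ‖z - v‖ ^ 2 := by
    rw [← norm_sub_sq_real, sub_sub_sub_cancel_right]
  rw [norm_sub_rev v z]
  exact le_of_sq_le_sq (by nlinarith [sq_nonneg ‖u - v‖]) (norm_nonneg _)

/-- The one-step inequality of the projected subgradient method. -/
theorem two_mul_step_mul_inner_le {E : Type*} [NormedAddCommGroup E]
    [InnerProductSpace ℝ E] {K : Set E} (hK : Convex ℝ K) {x v z g : E} {η : ℝ}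
    (hv : v ∈ K) (hz : z ∈ K)
    (hproj : ∀ z ∈ K, ‖v - (x - η • g)‖ ≤ ‖z - (x - η • g)‖) :
    2 * η * ⟪g, x - z⟫ ≤ ‖x - z‖ ^ 2 - ‖v - z‖ ^ 2 + η ^ 2 * ‖g‖ ^ 2 := by
  have hle := pow_le_pow_left₀ (norm_nonneg _)
    (norm_sub_le_of_forall_norm_sub_le_s1 hK hv hz hproj) 2
  have hsq : ‖x - η • g - z‖ ^ 2 = ‖x - z‖ ^ 2 - 2 * η * ⟪g, x - z⟫ + η ^ 2 * ‖g‖ ^ 2 := by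
    rw [show x - η • g - z = (x - z) - η • g by abel, norm_sub_sq_real, inner_smul_right,
      norm_smul, mul_pow, Real.norm_eq_abs, sq_abs, real_inner_comm]
    ring
  linarith

/-- A convex function at a weighted average is bounded by the value `m` plus the averaged gap. -/
theorem ConvexOn.map_weighted_average_sub_le {E ι : Type*} [AddCommGroup E] [Module ℝ E]
    {f : E → ℝ} (hf : ConvexOn ℝ Set.univ f) (S : Finset ι) (w : ι → ℝ) (x : ι → E) (m : ℝ)
    (hw : ∀ i ∈ S, 0 ≤ w i) (hpos : 0 < ∑ i ∈ S, w i) :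
    f ((∑ i ∈ S, w i)⁻¹ • ∑ i ∈ S, w i • x i) - m ≤
      (∑ i ∈ S, w i * (f (x i) - m)) / ∑ i ∈ S, w i := by
  have hJ := hf.map_centerMass_le hw hpos (fun i _ => Set.mem_univ (x i))
  simp only [Finset.centerMass, smul_eq_mul, Function.comp] at hJ
  have hsum : (∑ i ∈ S, w i * (f (x i) - m)) / ∑ i ∈ S, w i =
      (∑ i ∈ S, w i)⁻¹ * ∑ i ∈ S, w i * f (x i) - m := by
    simp only [mul_sub, Finset.sum_sub_distrib, ← Finset.sum_mul]
    field_simp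
  linarith

theorem stmt1 {n : ℕ} (X : Set (EuclideanSpace ℝ (Fin n)))
    (hXne : X.Nonempty) (hXcl : IsClosed X) (hXcv : Convex ℝ X)
    (R : ℝ) (hR : 0 < R)
    (xstar : EuclideanSpace ℝ (Fin n)) (hxstar : xstar ∈ X)
    (f : EuclideanSpace ℝ (Fin n) → ℝ) (hf : ConvexOn ℝ Set.univ f)
    (hball : X ⊆ Metric.closedBall xstar R)
    (hmin : ∀ z ∈ X, f xstar ≤ f z)
    (x g : ℕ → EuclideanSpace ℝ (Fin n)) (η : ℕ → ℝ)
    (hx1 : x 1 ∈ X)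
    (hηpos : ∀ s, 1 ≤ s → 0 < η s)
    (hsub : ∀ s, 1 ≤ s → ∀ z, f (x s) + ⟪g s, z - x s⟫ ≤ f z)
    (hmem : ∀ s, 1 ≤ s → x (s + 1) ∈ X)
    (hproj : ∀ s, 1 ≤ s → ∀ z ∈ X,
      ‖x (s + 1) - (x s - η s • g s)‖ ≤ ‖z - (x s - η s • g s)‖)
    (a : ℝ) (ha : a ∈ Set.Icc (0 : ℝ) 1)
    (t : ℕ) (ht : 1 ≤ t)
    (hgne : ∀ s, 1 ≤ s → s ≤ t → g s ≠ 0)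
    (G : ℕ → ℝ)
    (hG : ∀ s (hs : 1 ≤ s), G s =
      (Finset.Icc 1 s).sup' (Finset.nonempty_Icc.mpr hs)
        (fun j => ‖g j‖ * (j : ℝ) ^ ((1 - a) / 2)))
    (hη : ∀ s, 1 ≤ s → s ≤ t → η s = R / (G s * (s : ℝ) ^ (a / 2)))
    (k : ℝ) (hk : -1 ≤ k) (hk0 : k ≤ 0)
    (w : ℕ → ℝ) (hw : ∀ s, 1 ≤ s → w s = η s ^ (-k)) :
    f ((∑ s ∈ Finset.Icc 1 t, w s)⁻¹ • ∑ s ∈ Finset.Icc 1 t, w s • x s) - f xstar ≤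
      ((t : ℝ) ^ ((k + 1) / 2) + ∑ s ∈ Finset.Icc 1 t, (s : ℝ) ^ ((k - 1) / 2)) /
          (2 * ∑ s ∈ Finset.Icc 1 t, (s : ℝ) ^ (k / 2)) *
        (R * ((Finset.Icc 1 t).sup' (Finset.nonempty_Icc.mpr ht) fun s => ‖g s‖)) := by
  obtain ⟨ha0, ha1⟩ := ha
  set M := (Finset.Icc 1 t).sup' (Finset.nonempty_Icc.mpr ht) fun s => ‖g s‖ with hMdef
  have hgM : ∀ s, 1 ≤ s → s ≤ t → ‖g s‖ ≤ M := fun s h h' =>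
    Finset.le_sup' (fun s => ‖g s‖) (Finset.mem_Icc.2 ⟨h, h'⟩)
  have hgpos : ∀ s, 1 ≤ s → s ≤ t → 0 < ‖g s‖ := fun s h h' => norm_pos_iff.2 (hgne s h h')
  have hM : 0 < M := (hgpos 1 le_rfl ht).trans_le (hgM 1 le_rfl ht)
  have hs0 : ∀ s : ℕ, 1 ≤ s → (0 : ℝ) < s := fun s h => by exact_mod_cast h
  have hGlow : ∀ s, 1 ≤ s → ‖g s‖ * (s : ℝ) ^ ((1 - a) / 2) ≤ G s := fun s h => by
    rw [hG s h]
    exact Finset.le_sup' (fun j : ℕ => ‖g j‖ * (j : ℝ) ^ ((1 - a) / 2))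
      (Finset.mem_Icc.2 ⟨h, le_rfl⟩)
  have hGup : ∀ s, 1 ≤ s → s ≤ t → G s ≤ M * (s : ℝ) ^ ((1 - a) / 2) := fun s h h' => by
    rw [hG s h]
    refine Finset.sup'_le _ _ fun j hj => ?_
    obtain ⟨hj1, hjs⟩ := Finset.mem_Icc.1 hj
    exact mul_le_mul (hgM j hj1 (hjs.trans h'))
      (Real.rpow_le_rpow (hs0 j hj1).le (by exact_mod_cast hjs) (by linarith))
      (Real.rpow_nonneg (hs0 j hj1).le _) hM.le
  have hGmono : ∀ s, 1 ≤ s → G s ≤ G (s + 1) := fun s h => by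
    rw [hG s h, hG (s + 1) (by omega)]
    exact Finset.sup'_mono _ (Finset.Icc_subset_Icc_right (Nat.le_succ s)) _
  have hGpos : ∀ s, 1 ≤ s → s ≤ t → 0 < G s := fun s h h' =>
    (mul_pos (hgpos s h h') (Real.rpow_pos_of_pos (hs0 s h) _)).trans_le (hGlow s h)
  have hsplit : ∀ s : ℕ, 1 ≤ s →
      (s : ℝ) ^ ((1 - a) / 2) * (s : ℝ) ^ (a / 2) = (s : ℝ) ^ (1 / 2 : ℝ) := fun s h => by
    rw [← Real.rpow_add (hs0 s h)]
    congr 1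
    ring
  have hdiv : ∀ (s : ℕ) (c : ℝ), 1 ≤ s →
      R / (c * (s : ℝ) ^ ((1 - a) / 2) * (s : ℝ) ^ (a / 2)) =
        R / c * (s : ℝ) ^ (-(1 / 2) : ℝ) := fun s c h => by
    rw [mul_assoc, hsplit s h, Real.rpow_neg (hs0 s h).le, ← div_eq_mul_inv, div_div]
  have hηlow : ∀ s, 1 ≤ s → s ≤ t → R / M * (s : ℝ) ^ (-(1 / 2) : ℝ) ≤ η s := fun s h h' => by
    have hGs := hGpos s h h'
    have hp := Real.rpow_pos_of_pos (hs0 s h) (a / 2)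
    rw [hη s h h', ← hdiv s M h]
    exact div_le_div_of_nonneg_left hR.le (mul_pos hGs hp)
      (mul_le_mul_of_nonneg_right (hGup s h h') hp.le)
  have hηup : ∀ s, 1 ≤ s → s ≤ t → η s ≤ R / ‖g s‖ * (s : ℝ) ^ (-(1 / 2) : ℝ) :=
    fun s h h' => by
    have hgs := hgpos s h h'
    have hp := Real.rpow_pos_of_pos (hs0 s h) (a / 2)
    have hq := Real.rpow_pos_of_pos (hs0 s h) ((1 - a) / 2)
    rw [hη s h h', ← hdiv s ‖g s‖ h]
    exact div_le_div_of_nonneg_left hR.le (by positivity)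
      (mul_le_mul_of_nonneg_right (hGlow s h) hp.le)
  have hηanti : ∀ s, 1 ≤ s → s + 1 ≤ t → η (s + 1) ≤ η s := fun s h h' => by
    have hGs := hGpos s h (by omega)
    rw [hη s h (by omega), hη (s + 1) (by omega) h']
    refine div_le_div_of_nonneg_left hR.le
      (mul_pos hGs (Real.rpow_pos_of_pos (hs0 s h) _)) ?_
    exact mul_le_mul (hGmono s h)
      (Real.rpow_le_rpow (hs0 s h).le (by push_cast; linarith) (by linarith))
      (Real.rpow_nonneg (hs0 s h).le _) (hGs.le.trans (hGmono s h))
  set c := R / M with hcdef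
  have hc : 0 < c := div_pos hR hM
  have hscale : ∀ (s : ℕ) (u v : ℝ), 1 ≤ s → 0 ≤ u →
      (u * (s : ℝ) ^ (-(1 / 2) : ℝ)) ^ v = u ^ v * (s : ℝ) ^ (-v / 2) := fun s u v h hu => by
    rw [Real.mul_rpow hu (Real.rpow_nonneg (hs0 s h).le _), ← Real.rpow_mul (hs0 s h).le]
    congr 2
    ring
  have hwlow : ∀ s, 1 ≤ s → s ≤ t → c ^ (-k) * (s : ℝ) ^ (k / 2) ≤ w s := fun s h h' => by
    have := Real.rpow_le_rpow (mul_nonneg hc.le (Real.rpow_nonneg (hs0 s h).le _))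
      (hηlow s h h') (neg_nonneg.2 hk0)
    rwa [hscale s c (-k) h hc.le, neg_neg, ← hw s h] at this
  have hlast : η t ^ (-(k + 1)) ≤ c ^ (-(k + 1)) * (t : ℝ) ^ ((k + 1) / 2) := by
    have := Real.rpow_le_rpow_of_nonpos (mul_pos hc (Real.rpow_pos_of_pos (hs0 t ht) _))
      (hηlow t ht le_rfl) (show -(k + 1) ≤ 0 by linarith)
    rwa [hscale t c (-(k + 1)) ht hc.le, neg_neg] at this
  have hnoise : ∀ s, 1 ≤ s → s ≤ t →
      η s ^ (1 - k) * ‖g s‖ ^ 2 ≤ R ^ 2 * c ^ (-(k + 1)) * (s : ℝ) ^ ((k - 1) / 2) :=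
    fun s h h' => by
    have hgs := hgpos s h h'
    have hr : 0 < R / ‖g s‖ := div_pos hR hgs
    have hp := Real.rpow_nonneg (hs0 s h).le ((k - 1) / 2)
    have hpow := Real.rpow_le_rpow (hηpos s h).le (hηup s h h') (show 0 ≤ 1 - k by linarith)
    rw [hscale s _ (1 - k) h hr.le, neg_sub] at hpow
    have hsplitr : (R / ‖g s‖) ^ (1 - k) = (R / ‖g s‖) ^ (-(k + 1)) * (R / ‖g s‖) ^ 2 := by
      rw [← Real.rpow_natCast, ← Real.rpow_add hr]
      congr 1
      push_cast
      ring
    have hcr : (R / ‖g s‖) ^ (-(k + 1)) ≤ c ^ (-(k + 1)) :=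
      Real.rpow_le_rpow_of_nonpos hc (div_le_div_of_nonneg_left hR.le hgs (hgM s h h'))
        (by linarith)
    calc η s ^ (1 - k) * ‖g s‖ ^ 2
        ≤ (R / ‖g s‖) ^ (1 - k) * (s : ℝ) ^ ((k - 1) / 2) * ‖g s‖ ^ 2 := by gcongr
      _ = R ^ 2 * (R / ‖g s‖) ^ (-(k + 1)) * (s : ℝ) ^ ((k - 1) / 2) := by
          rw [hsplitr]
          field_simp
      _ ≤ R ^ 2 * c ^ (-(k + 1)) * (s : ℝ) ^ ((k - 1) / 2) := by gcongr
  have hxmem : ∀ s, 1 ≤ s → x s ∈ X := fun s h => by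
    obtain rfl | h' := h.eq_or_lt
    · exact hx1
    · obtain ⟨m, rfl⟩ : ∃ m, s = m + 1 := ⟨s - 1, by omega⟩
      exact hmem m (by omega)
  have hdist : ∀ s, 1 ≤ s → ‖x s - xstar‖ ^ 2 ≤ R ^ 2 := fun s h =>
    pow_le_pow_left₀ (norm_nonneg _) (mem_closedBall_iff_norm.1 (hball (hxmem s h))) 2
  have hstep : ∀ s, 1 ≤ s → w s * (f (x s) - f xstar) ≤
      1 / 2 * (η s ^ (-(k + 1)) * (‖x s - xstar‖ ^ 2 - ‖x (s + 1) - xstar‖ ^ 2)) +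
        1 / 2 * (η s ^ (1 - k) * ‖g s‖ ^ 2) := fun s h => by
    have hηs := hηpos s h
    have hone := two_mul_step_mul_inner_le hXcv (hmem s h) hxstar (hproj s h)
    have hgap := hsub s h xstar
    rw [← neg_sub (x s) xstar, inner_neg_right] at hgap
    have hpos := Real.rpow_pos_of_pos hηs (-(k + 1))
    have hw1 : w s = η s ^ (-(k + 1)) * η s := by
      rw [hw s h, ← Real.rpow_add_one hηs.ne']
      congr 1
      ring
    have hw2 : η s ^ (1 - k) = η s ^ (-(k + 1)) * η s ^ 2 := by
      rw [← Real.rpow_natCast, ← Real.rpow_add hηs]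
      congr 1
      push_cast
      ring
    have hgap' : 2 * η s * (f (x s) - f xstar) ≤ 2 * η s * ⟪g s, x s - xstar⟫ :=
      mul_le_mul_of_nonneg_left (by linarith) (by linarith)
    have hmul := mul_le_mul_of_nonneg_left (hgap'.trans hone) hpos.le
    rw [hw1, hw2]
    linarith
  have habel := sum_Icc_mul_sub_succ_le (fun s => η s ^ (-(k + 1)))
    (fun s => ‖x s - xstar‖ ^ 2) (R ^ 2) t ht
    (fun s h _ => Real.rpow_nonneg (hηpos s h).le _)
    (fun s h h' => Real.rpow_le_rpow_of_nonpos (hηpos (s + 1) (by omega)) (hηanti s h h')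
      (by linarith)) hdist
  set A := (t : ℝ) ^ ((k + 1) / 2) + ∑ s ∈ Finset.Icc 1 t, (s : ℝ) ^ ((k - 1) / 2) with hA
  set B := ∑ s ∈ Finset.Icc 1 t, (s : ℝ) ^ (k / 2) with hB
  have hBpos : 0 < B := Finset.sum_pos
    (fun s hs => Real.rpow_pos_of_pos (hs0 s (Finset.mem_Icc.1 hs).1) _)
    (Finset.nonempty_Icc.mpr ht)
  have hApos : 0 ≤ A := by positivity
  have hW : c ^ (-k) * B ≤ ∑ s ∈ Finset.Icc 1 t, w s := by
    rw [hB, Finset.mul_sum]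
    exact Finset.sum_le_sum fun s hs =>
      hwlow s (Finset.mem_Icc.1 hs).1 (Finset.mem_Icc.1 hs).2
  have hck := Real.rpow_pos_of_pos hc (-k)
  have hck1 := Real.rpow_pos_of_pos hc (-(k + 1))
  have hsum : ∑ s ∈ Finset.Icc 1 t, w s * (f (x s) - f xstar) ≤
      R ^ 2 * c ^ (-(k + 1)) * A / 2 := by
    have h1 := Finset.sum_le_sum fun s (hs : s ∈ Finset.Icc 1 t) =>
      hstep s (Finset.mem_Icc.1 hs).1
    have h2 := Finset.sum_le_sum fun s (hs : s ∈ Finset.Icc 1 t) =>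
      hnoise s (Finset.mem_Icc.1 hs).1 (Finset.mem_Icc.1 hs).2
    rw [Finset.sum_add_distrib, ← Finset.mul_sum, ← Finset.mul_sum] at h1
    rw [← Finset.mul_sum] at h2
    have h3 := mul_le_mul_of_nonneg_left hlast (sq_nonneg R)
    have h4 := mul_nonneg (Real.rpow_nonneg (hηpos t ht).le (-(k + 1)))
      (sq_nonneg ‖x (t + 1) - xstar‖)
    rw [hA]
    linarith
  have hfinal := hf.map_weighted_average_sub_le (Finset.Icc 1 t) w x (f xstar)
    (fun s hs => by
      rw [hw s (Finset.mem_Icc.1 hs).1]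
      exact Real.rpow_nonneg (hηpos s (Finset.mem_Icc.1 hs).1).le _)
    ((mul_pos hck hBpos).trans_le hW)
  refine hfinal.trans ?_
  calc (∑ s ∈ Finset.Icc 1 t, w s * (f (x s) - f xstar)) / ∑ s ∈ Finset.Icc 1 t, w s
      ≤ (R ^ 2 * c ^ (-(k + 1)) * A / 2) / (c ^ (-k) * B) :=
        div_le_div₀ (by positivity) hsum (by positivity) hW
    _ = A / (2 * B) * (R * M) := by
        have hcc : c ^ (-k) = c ^ (-(k + 1)) * c := by
          rw [← Real.rpow_add_one hc.ne']
          congr 1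
          ring
        have hR2 : R ^ 2 = R * M * c := by
          rw [hcdef]
          field_simp
        rw [hcc, hR2]
        field_simp
end

section
/- Let t ≥ 1, fix a ∈ [0,1] and k > 0. Suppose the projected subgradient method is run with η_s = R/(G_s · s^{a/2}), G_s = max_{1≤j≤s} ‖g_j‖ · j^{(1−a)/2} (each g_s ≠ 0), and set weights w_s = s^{k/2}. Then f((Σ_{s=1}^t w_s x_s)/(Σ_{s=1}^t w_s)) − f(x*) ≤ [(t^{(k+1)/2} + Σ_{s=1}^t s^{(k−1)/2}) / (2 Σ_{s=1}^t s^{k/2})] · R · max_{s=1,…,t} ‖g_s‖. -/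
open scoped RealInnerProductSpace

/-- A nearest point `p` of a convex set to `y` is at least as close as `y` to each point of it. -/
theorem norm_sub_sq_le_of_nearest {E : Type*} [NormedAddCommGroup E] [InnerProductSpace ℝ E]
    {X : Set E} (hX : Convex ℝ X) {y p z : E} (hp : p ∈ X) (hz : z ∈ X)
    (hnear : ∀ u ∈ X, ‖p - y‖ ≤ ‖u - y‖) : ‖p - z‖ ^ 2 ≤ ‖y - z‖ ^ 2 := by
  have hinf : ‖y - p‖ = ⨅ u : X, ‖y - u‖ := by
    have : Nonempty X := ⟨⟨p, hp⟩⟩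
    refine le_antisymm (le_ciInf fun u => ?_) ?_
    · rw [norm_sub_rev y p, norm_sub_rev y u]
      exact hnear u u.2
    · exact ciInf_le ⟨0, by rintro _ ⟨u, rfl⟩; exact norm_nonneg _⟩ (⟨p, hp⟩ : X)
  have hinner := (norm_eq_iInf_iff_real_inner_le_zero hX hp).1 hinf z hz
  have hexp := norm_sub_sq_real (y - p) (z - p)
  rw [sub_sub_sub_cancel_right, norm_sub_rev z p] at hexp
  nlinarith [sq_nonneg ‖y - p‖]

/-- Summation by parts bound for nondecreasing coefficients and a bounded sequence. -/
theorem sum_Icc_mul_sub_succ_le_s2 {c d : ℕ → ℝ} {B : ℝ} (hc1 : 0 ≤ c 1)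
    (hc : ∀ s, 1 ≤ s → c s ≤ c (s + 1)) (hd : ∀ s, 1 ≤ s → d s ≤ B) {m : ℕ} (hm : 1 ≤ m) :
    ∑ s ∈ Finset.Icc 1 m, c s * (d s - d (s + 1)) ≤ c m * (B - d (m + 1)) := by
  induction m, hm using Nat.le_induction with
  | base =>
    rw [Finset.Icc_self, Finset.sum_singleton]
    exact mul_le_mul_of_nonneg_left (by linarith [hd 1 le_rfl]) hc1
  | succ m hm ih =>
    rw [Finset.sum_Icc_succ_top (by omega)]
    nlinarith [mul_nonneg (sub_nonneg.2 (hc m hm)) (sub_nonneg.2 (hd (m + 1) (by omega)))]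

/-- One step of the projected subgradient method. -/
theorem two_mul_step_mul_gap_le {E : Type*} [NormedAddCommGroup E] [InnerProductSpace ℝ E]
    {X : Set E} (hX : Convex ℝ X) {f : E → ℝ} {x p g z : E} {η : ℝ} (hη : 0 ≤ η)
    (hp : p ∈ X) (hz : z ∈ X) (hsub : f x + ⟪g, z - x⟫ ≤ f z)
    (hnear : ∀ u ∈ X, ‖p - (x - η • g)‖ ≤ ‖u - (x - η • g)‖) :
    2 * η * (f x - f z) ≤ ‖x - z‖ ^ 2 - ‖p - z‖ ^ 2 + η ^ 2 * ‖g‖ ^ 2 := by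
  have h := norm_sub_sq_le_of_nearest hX hp hz hnear
  rw [sub_right_comm, norm_sub_sq_real (x - z) (η • g), real_inner_smul_right, norm_smul,
    Real.norm_of_nonneg hη, mul_pow, real_inner_comm] at h
  have hneg : ⟪g, z - x⟫ = -⟪g, x - z⟫ := by rw [← inner_neg_right, neg_sub]
  rw [hneg] at hsub
  nlinarith [mul_le_mul_of_nonneg_left hsub hη]

theorem stmt2 {n : ℕ} (X : Set (EuclideanSpace ℝ (Fin n)))
    (hXne : X.Nonempty) (hXcl : IsClosed X) (hXcv : Convex ℝ X)
    (R : ℝ) (hR : 0 < R)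
    (xstar : EuclideanSpace ℝ (Fin n)) (hxstar : xstar ∈ X)
    (f : EuclideanSpace ℝ (Fin n) → ℝ) (hf : ConvexOn ℝ Set.univ f)
    (hball : X ⊆ Metric.closedBall xstar R)
    (hmin : ∀ z ∈ X, f xstar ≤ f z)
    (x g : ℕ → EuclideanSpace ℝ (Fin n)) (η : ℕ → ℝ)
    (hx1 : x 1 ∈ X)
    (hηpos : ∀ s, 1 ≤ s → 0 < η s)
    (hsub : ∀ s, 1 ≤ s → ∀ z, f (x s) + ⟪g s, z - x s⟫ ≤ f z)
    (hmem : ∀ s, 1 ≤ s → x (s + 1) ∈ X)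
    (hproj : ∀ s, 1 ≤ s → ∀ z ∈ X,
      ‖x (s + 1) - (x s - η s • g s)‖ ≤ ‖z - (x s - η s • g s)‖)
    (a : ℝ) (ha : a ∈ Set.Icc (0 : ℝ) 1)
    (t : ℕ) (ht : 1 ≤ t)
    (hgne : ∀ s, 1 ≤ s → s ≤ t → g s ≠ 0)
    (G : ℕ → ℝ)
    (hG : ∀ s (hs : 1 ≤ s), G s =
      (Finset.Icc 1 s).sup' (Finset.nonempty_Icc.mpr hs)
        (fun j => ‖g j‖ * (j : ℝ) ^ ((1 - a) / 2)))
    (hη : ∀ s, 1 ≤ s → s ≤ t → η s = R / (G s * (s : ℝ) ^ (a / 2)))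
    (k : ℝ) (hk : 0 < k)
    (w : ℕ → ℝ) (hw : ∀ s, 1 ≤ s → w s = (s : ℝ) ^ (k / 2)) :
    f ((∑ s ∈ Finset.Icc 1 t, w s)⁻¹ • ∑ s ∈ Finset.Icc 1 t, w s • x s) - f xstar ≤
      ((t : ℝ) ^ ((k + 1) / 2) + ∑ s ∈ Finset.Icc 1 t, (s : ℝ) ^ ((k - 1) / 2)) /
          (2 * ∑ s ∈ Finset.Icc 1 t, (s : ℝ) ^ (k / 2)) *
        (R * ((Finset.Icc 1 t).sup' (Finset.nonempty_Icc.mpr ht) fun s => ‖g s‖)) := by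
  set M := (Finset.Icc 1 t).sup' (Finset.nonempty_Icc.mpr ht) fun s => ‖g s‖
  have hgM : ∀ s, 1 ≤ s → s ≤ t → ‖g s‖ ≤ M := fun s h1 h2 =>
    Finset.le_sup' (fun s => ‖g s‖) (Finset.mem_Icc.2 ⟨h1, h2⟩)
  have hpos : ∀ s : ℕ, 1 ≤ s → (0 : ℝ) < s := fun s hs => by exact_mod_cast hs
  have hGge : ∀ s, 1 ≤ s → ‖g s‖ * (s : ℝ) ^ ((1 - a) / 2) ≤ G s := fun s hs => by
    rw [hG s hs]
    exact Finset.le_sup' (fun j : ℕ => ‖g j‖ * (j : ℝ) ^ ((1 - a) / 2))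
      (Finset.mem_Icc.2 ⟨hs, le_rfl⟩)
  have hG0 : ∀ s, 1 ≤ s → 0 ≤ G s := fun s hs =>
    le_trans (by have := hpos s hs; positivity) (hGge s hs)
  have hGmono : ∀ s, 1 ≤ s → G s ≤ G (s + 1) := fun s hs => by
    rw [hG s hs, hG (s + 1) (by omega)]
    exact Finset.sup'_mono _ (Finset.Icc_subset_Icc_right (by omega)) _
  have hGt : G t ≤ M * (t : ℝ) ^ ((1 - a) / 2) := by
    rw [hG t ht]
    refine Finset.sup'_le _ _ fun j hj => ?_
    obtain ⟨hj1, hj2⟩ := Finset.mem_Icc.1 hj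
    have hjt : (j : ℝ) ≤ t := by exact_mod_cast hj2
    have hM0 : 0 ≤ M := (norm_nonneg _).trans (hgM j hj1 hj2)
    exact mul_le_mul (hgM j hj1 hj2)
      (Real.rpow_le_rpow (hpos j hj1).le hjt (by linarith [ha.2])) (by positivity) hM0
  set c : ℕ → ℝ := fun s => (s : ℝ) ^ ((k + a) / 2) * G s / R with hc
  set d : ℕ → ℝ := fun s => ‖x s - xstar‖ ^ 2
  have hxX : ∀ s, 1 ≤ s → x s ∈ X := fun s hs => by
    obtain rfl | hs' := eq_or_lt_of_le hs
    · exact hx1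
    · obtain ⟨r, rfl⟩ := Nat.exists_eq_add_of_lt hs'
      exact hmem _ (by omega)
  have hdR : ∀ s, 1 ≤ s → d s ≤ R ^ 2 := fun s hs => by
    have := hball (hxX s hs)
    rw [mem_closedBall_iff_norm] at this
    exact pow_le_pow_left₀ (norm_nonneg _) this 2
  have hc0 : ∀ s, 1 ≤ s → 0 ≤ c s := fun s hs => by
    have := hG0 s hs
    have := hpos s hs
    positivity
  have hcmono : ∀ s, 1 ≤ s → c s ≤ c (s + 1) := fun s hs => by
    have h1 := hG0 s hs
    have h2 := hGmono s hs
    have h3 := ha.1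
    have h4 : (s : ℝ) ≤ ((s + 1 : ℕ) : ℝ) := by push_cast; linarith
    have h5 := Real.rpow_le_rpow (hpos s hs).le h4 (by linarith : 0 ≤ (k + a) / 2)
    exact div_le_div_of_nonneg_right (mul_le_mul h5 h2 h1 (by positivity)) hR.le
  have hstep : ∀ s ∈ Finset.Icc 1 t, 2 * (w s * (f (x s) - f xstar)) ≤
      c s * (d s - d (s + 1)) + (s : ℝ) ^ ((k - 1) / 2) * (R * M) := fun s hs => by
    obtain ⟨hs1, hst⟩ := Finset.mem_Icc.1 hs
    have hs0 := hpos s hs1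
    have hgs : 0 < ‖g s‖ := norm_pos_iff.2 (hgne s hs1 hst)
    have hGs : 0 < G s := lt_of_lt_of_le (by positivity) (hGge s hs1)
    have hcη : c s * η s = w s := by
      rw [hw s hs1, hη s hs1 hst]
      simp only [hc]
      rw [add_div, Real.rpow_add hs0]
      field_simp
    have hmul := mul_le_mul_of_nonneg_left (two_mul_step_mul_gap_le hXcv (hηpos s hs1).le
      (hmem s hs1) hxstar (hsub s hs1 xstar) (hproj s hs1)) (hc0 s hs1)
    have hηg : w s * (η s * ‖g s‖) ≤ (s : ℝ) ^ ((k - 1) / 2) * R := by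
      have hsplit : (s : ℝ) ^ (k / 2) =
          (s : ℝ) ^ ((k - 1) / 2) * ((s : ℝ) ^ ((1 - a) / 2) * (s : ℝ) ^ (a / 2)) := by
        rw [← Real.rpow_add hs0, ← Real.rpow_add hs0]
        congr 1
        ring
      rw [hw s hs1, hη s hs1 hst, hsplit]
      calc _ = (s : ℝ) ^ ((k - 1) / 2) * R * ((‖g s‖ * (s : ℝ) ^ ((1 - a) / 2)) / G s) := by
            field_simp
        _ ≤ (s : ℝ) ^ ((k - 1) / 2) * R * 1 := by
            gcongr
            exact (div_le_one hGs).2 (hGge s hs1)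
        _ = _ := mul_one _
    have herr : w s * (η s * ‖g s‖) * ‖g s‖ ≤ (s : ℝ) ^ ((k - 1) / 2) * R * M :=
      mul_le_mul hηg (hgM s hs1 hst) hgs.le (by positivity)
    calc 2 * (w s * (f (x s) - f xstar)) = c s * (2 * η s * (f (x s) - f xstar)) := by
          rw [← hcη]; ring
      _ ≤ c s * (d s - d (s + 1) + η s ^ 2 * ‖g s‖ ^ 2) := hmul
      _ = c s * (d s - d (s + 1)) + w s * (η s * ‖g s‖) * ‖g s‖ := by rw [← hcη]; ring
      _ ≤ _ := by linarith
  have hsum := Finset.sum_le_sum hstep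
  rw [← Finset.mul_sum, Finset.sum_add_distrib, ← Finset.sum_mul] at hsum
  have habel := sum_Icc_mul_sub_succ_le_s2 (hc0 1 le_rfl) hcmono hdR ht
  have hct : c t * (R ^ 2 - d (t + 1)) ≤ (t : ℝ) ^ ((k + 1) / 2) * (R * M) := by
    have ht0 := hpos t ht
    have hsplit : (t : ℝ) ^ ((k + 1) / 2) =
        (t : ℝ) ^ ((k + a) / 2) * (t : ℝ) ^ ((1 - a) / 2) := by
      rw [← Real.rpow_add ht0]
      congr 1
      ring
    calc c t * (R ^ 2 - d (t + 1)) ≤ c t * R ^ 2 :=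
          mul_le_mul_of_nonneg_left (sub_le_self _ (sq_nonneg _)) (hc0 t ht)
      _ = (t : ℝ) ^ ((k + a) / 2) * R * G t := by simp only [hc]; field_simp
      _ ≤ (t : ℝ) ^ ((k + a) / 2) * R * (M * (t : ℝ) ^ ((1 - a) / 2)) := by gcongr
      _ = _ := by rw [hsplit]; ring
  have hwsum : ∑ s ∈ Finset.Icc 1 t, (s : ℝ) ^ (k / 2) = ∑ s ∈ Finset.Icc 1 t, w s :=
    Finset.sum_congr rfl fun s hs => (hw s (Finset.mem_Icc.1 hs).1).symm
  have hw0 : ∀ s ∈ Finset.Icc 1 t, 0 < w s := fun s hs => by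
    have hs1 := (Finset.mem_Icc.1 hs).1
    rw [hw s hs1]
    exact Real.rpow_pos_of_pos (hpos s hs1) _
  have hW : 0 < ∑ s ∈ Finset.Icc 1 t, w s :=
    Finset.sum_pos hw0 (Finset.nonempty_Icc.mpr ht)
  have hjensen := hf.map_centerMass_le (fun s hs => (hw0 s hs).le) hW
    (fun s _ => Set.mem_univ (x s))
  simp only [Finset.centerMass, Function.comp_apply, smul_eq_mul] at hjensen
  have hgap : ∑ s ∈ Finset.Icc 1 t, w s * (f (x s) - f xstar) =
      ∑ s ∈ Finset.Icc 1 t, w s * f (x s) - (∑ s ∈ Finset.Icc 1 t, w s) * f xstar := by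
    simp only [mul_sub, Finset.sum_sub_distrib, Finset.sum_mul]
  rw [hwsum]
  calc _ ≤ (∑ s ∈ Finset.Icc 1 t, w s)⁻¹ * ∑ s ∈ Finset.Icc 1 t, w s * f (x s) - f xstar :=
        sub_le_sub_right hjensen _
    _ = 2 * (∑ s ∈ Finset.Icc 1 t, w s * (f (x s) - f xstar)) /
        (2 * ∑ s ∈ Finset.Icc 1 t, w s) := by
        rw [hgap]
        field_simp
    _ ≤ ((t : ℝ) ^ ((k + 1) / 2) + ∑ s ∈ Finset.Icc 1 t, (s : ℝ) ^ ((k - 1) / 2)) * (R * M) /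
        (2 * ∑ s ∈ Finset.Icc 1 t, w s) := by
        refine div_le_div_of_nonneg_right ?_ (by positivity)
        linarith
    _ = _ := by ring
end

section
/- Let t ≥ 1 and L > 0, and suppose ‖g_s‖ ≤ L for all s = 1,…,t. If the projected subgradient method is run with the classic time-varying step-size η_s = R/(L√s) for s = 1,…,t, then f((1/t)·Σ_{s=1}^t x_s) − f(x*) ≤ 3RL/(2√t). -/
open scoped RealInnerProductSpace

/-- The nearest point of a convex set to `y` is at least as close to every point of the set as `y`
is. -/
theorem norm_sub_sq_le_of_isNearest {E : Type*} [NormedAddCommGroup E] [InnerProductSpace ℝ E]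
    {X : Set E} (hX : Convex ℝ X) {p y z : E} (hp : p ∈ X)
    (hnear : ∀ w ∈ X, ‖p - y‖ ≤ ‖w - y‖) (hz : z ∈ X) :
    ‖p - z‖ ^ 2 ≤ ‖y - z‖ ^ 2 := by
  have hinf : ‖y - p‖ = ⨅ w : X, ‖y - w‖ := by
    have : Nonempty X := ⟨⟨p, hp⟩⟩
    refine le_antisymm (le_ciInf fun w => ?_) ?_
    · rw [norm_sub_rev y p, norm_sub_rev y w]
      exact hnear w w.2
    · exact ciInf_le (f := fun w : X => ‖y - w‖)
        ⟨0, by rintro _ ⟨w, rfl⟩; exact norm_nonneg _⟩ ⟨p, hp⟩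
  have hin := (norm_eq_iInf_iff_real_inner_le_zero hX hp).1 hinf z hz
  have hexp := norm_sub_sq_real (y - p) (z - p)
  rw [sub_sub_sub_cancel_right, norm_sub_rev z p] at hexp
  nlinarith [sq_nonneg ‖y - p‖]

/-- One step of the projected subgradient method, with step-size `η`. -/
theorem subgradient_step_bound {E : Type*} [NormedAddCommGroup E] [InnerProductSpace ℝ E]
    {X : Set E} (hX : Convex ℝ X) {f : E → ℝ} {x x' g z : E} {η L : ℝ} (hη : 0 < η)
    (hg : ‖g‖ ≤ L) (hsub : f x + ⟪g, z - x⟫ ≤ f z) (hx' : x' ∈ X)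
    (hproj : ∀ w ∈ X, ‖x' - (x - η • g)‖ ≤ ‖w - (x - η • g)‖) (hz : z ∈ X) :
    2 * η * (f x - f z) ≤ ‖x - z‖ ^ 2 - ‖x' - z‖ ^ 2 + η ^ 2 * L ^ 2 := by
  have h := norm_sub_sq_le_of_isNearest hX hx' hproj hz
  have hexp := norm_sub_sq_real (x - z) (η • g)
  rw [sub_right_comm, norm_smul, real_inner_smul_right, Real.norm_of_nonneg hη.le,
    real_inner_comm, mul_pow] at hexp
  have hgL : ‖g‖ ^ 2 ≤ L ^ 2 := pow_le_pow_left₀ (norm_nonneg g) hg 2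
  have hneg : ⟪g, z - x⟫ = -⟪g, x - z⟫ := by rw [← inner_neg_right, neg_sub]
  rw [hneg] at hsub
  nlinarith [mul_le_mul_of_nonneg_left hgL (sq_nonneg η),
    mul_le_mul_of_nonneg_left hsub hη.le]

theorem one_div_two_mul_sqrt_succ_le (k : ℕ) :
    1 / (2 * √((k + 1 : ℕ) : ℝ)) ≤ √((k + 1 : ℕ) : ℝ) - √(k : ℝ) := by
  have hc : 0 < √((k + 1 : ℕ) : ℝ) := Real.sqrt_pos.2 (by positivity)
  have hb2 := Real.sq_sqrt (Nat.cast_nonneg (α := ℝ) k)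
  have hc2 := Real.sq_sqrt (Nat.cast_nonneg (α := ℝ) (k + 1))
  rw [div_le_iff₀ (by positivity)]
  push_cast at *
  nlinarith [sq_nonneg (√((k : ℝ) + 1) - √(k : ℝ))]

theorem stmt4 {n : ℕ} (X : Set (EuclideanSpace ℝ (Fin n)))
    (hXne : X.Nonempty) (hXcl : IsClosed X) (hXcv : Convex ℝ X)
    (R : ℝ) (hR : 0 < R)
    (xstar : EuclideanSpace ℝ (Fin n)) (hxstar : xstar ∈ X)
    (f : EuclideanSpace ℝ (Fin n) → ℝ) (hf : ConvexOn ℝ Set.univ f)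
    (hball : X ⊆ Metric.closedBall xstar R)
    (hmin : ∀ z ∈ X, f xstar ≤ f z)
    (x g : ℕ → EuclideanSpace ℝ (Fin n)) (η : ℕ → ℝ)
    (hx1 : x 1 ∈ X)
    (hηpos : ∀ s, 1 ≤ s → 0 < η s)
    (hsub : ∀ s, 1 ≤ s → ∀ z, f (x s) + ⟪g s, z - x s⟫ ≤ f z)
    (hmem : ∀ s, 1 ≤ s → x (s + 1) ∈ X)
    (hproj : ∀ s, 1 ≤ s → ∀ z ∈ X,
      ‖x (s + 1) - (x s - η s • g s)‖ ≤ ‖z - (x s - η s • g s)‖)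
    (t : ℕ) (ht : 1 ≤ t)
    (L : ℝ) (hL : 0 < L)
    (hLip : ∀ s, 1 ≤ s → s ≤ t → ‖g s‖ ≤ L)
    (hη : ∀ s, 1 ≤ s → s ≤ t → η s = R / (L * Real.sqrt s)) :
    f ((1 / (t : ℝ)) • ∑ s ∈ Finset.Icc 1 t, x s) - f xstar ≤
      3 * R * L / (2 * Real.sqrt t) := by
  have hdist : ∀ s, 1 ≤ s → ‖x s - xstar‖ ^ 2 ≤ R ^ 2 := by
    intro s hs
    have hxs : x s ∈ X := by
      obtain rfl | ⟨k, hk, rfl⟩ : s = 1 ∨ ∃ k, 1 ≤ k ∧ s = k + 1 := by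
        rcases hs.eq_or_lt with h | h
        · exact Or.inl h.symm
        · exact Or.inr ⟨s - 1, by omega, by omega⟩
      · exact hx1
      · exact hmem k hk
    exact pow_le_pow_left₀ (norm_nonneg _) (mem_closedBall_iff_norm.1 (hball hxs)) 2
  have hsum : ∀ k, k ≤ t → ∑ s ∈ Finset.Icc 1 k, (f (x s) - f xstar)
      + ‖x (k + 1) - xstar‖ ^ 2 * (L * √(k : ℝ) / (2 * R)) ≤ 3 / 2 * R * L * √(k : ℝ) := by
    intro k
    induction k with
    | zero => simp
    | succ k ih =>
      intro hk
      have ih := ih (by omega)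
      have hs : 1 ≤ k + 1 := by omega
      have hstep := subgradient_step_bound hXcv (hηpos _ hs) (hLip _ hs hk)
        (hsub _ hs xstar) (hmem _ hs) (hproj _ hs) hxstar
      rw [hη _ hs hk] at hstep
      rw [Finset.sum_Icc_succ_top hs]
      have hc : 0 < √((k + 1 : ℕ) : ℝ) := Real.sqrt_pos.2 (by positivity)
      have hcb := one_div_two_mul_sqrt_succ_le k
      have hd := hdist _ hs
      generalize √((k + 1 : ℕ) : ℝ) = c at *
      generalize √(k : ℝ) = b at *
      generalize ‖x (k + 1) - xstar‖ ^ 2 = d at *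
      generalize ‖x (k + 1 + 1) - xstar‖ ^ 2 = d' at *
      generalize f (x (k + 1)) - f xstar = δ at *
      have hδ : δ ≤ (d - d') * (L * c / (2 * R)) + R * L * (1 / (2 * c)) := by
        have h := mul_le_mul_of_nonneg_left hstep
          (show 0 ≤ L * c / (2 * R) by positivity)
        have h₁ : L * c / (2 * R) * (2 * (R / (L * c)) * δ) = δ := by field_simp
        have h₂ : L * c / (2 * R) * (d - d' + (R / (L * c)) ^ 2 * L ^ 2)
            = (d - d') * (L * c / (2 * R)) + R * L * (1 / (2 * c)) := by field_simp
        linarith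
      have hcb₀ : 0 ≤ c - b := le_trans (by positivity) hcb
      have hd' : d * (L * (c - b) / (2 * R)) ≤ R * L * (c - b) / 2 := by
        calc d * (L * (c - b) / (2 * R)) ≤ R ^ 2 * (L * (c - b) / (2 * R)) :=
              mul_le_mul_of_nonneg_right hd (by positivity)
          _ = R * L * (c - b) / 2 := by field_simp
      have hRL := mul_le_mul_of_nonneg_left hcb (mul_pos hR hL).le
      have hsplit : d * (L * (c - b) / (2 * R))
          = d * (L * c / (2 * R)) - d * (L * b / (2 * R)) := by ring
      linarith
  have ht₀ : (0 : ℝ) < t := by exact_mod_cast ht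
  have hjensen : f ((1 / (t : ℝ)) • ∑ s ∈ Finset.Icc 1 t, x s)
      ≤ 1 / (t : ℝ) * ∑ s ∈ Finset.Icc 1 t, f (x s) := by
    rw [Finset.smul_sum, Finset.mul_sum]
    refine hf.map_sum_le (fun _ _ => by positivity) ?_ (fun _ _ => Set.mem_univ _)
    simp [ht₀.ne']
  have htotal : ∑ s ∈ Finset.Icc 1 t, f (x s) - t * f xstar ≤ 3 / 2 * R * L * √(t : ℝ) := by
    have h := hsum t le_rfl
    rw [Finset.sum_sub_distrib, Finset.sum_const, Nat.card_Icc, nsmul_eq_mul,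
      Nat.add_sub_cancel] at h
    have : 0 ≤ ‖x (t + 1) - xstar‖ ^ 2 * (L * √(t : ℝ) / (2 * R)) := by positivity
    linarith
  have hsq := Real.sq_sqrt ht₀.le
  have hst := Real.sqrt_pos.2 ht₀
  calc f ((1 / (t : ℝ)) • ∑ s ∈ Finset.Icc 1 t, x s) - f xstar
      ≤ 1 / (t : ℝ) * (∑ s ∈ Finset.Icc 1 t, f (x s) - t * f xstar) := by
        rw [mul_sub, ← mul_assoc, one_div_mul_cancel ht₀.ne', one_mul]
        linarith
    _ ≤ 1 / (t : ℝ) * (3 / 2 * R * L * √(t : ℝ)) :=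
        mul_le_mul_of_nonneg_left htotal (by positivity)
    _ = 3 * R * L / (2 * √(t : ℝ)) := by
        rw [eq_div_iff (by positivity), one_div_mul_eq_div, div_mul_eq_mul_div,
          div_eq_iff ht₀.ne']
        linear_combination 3 * R * L * hsq
end

section
/- Let t ≥ 1 and L > 0, and suppose ‖g_s‖ ≤ L for all s = 1,…,t. If the projected subgradient method is run with the constant step-size η_s ≡ R/(L√t) for s = 1,…,t, then f((1/t)·Σ_{s=1}^t x_s) − f(x*) ≤ RL/√t. -/
open scoped RealInnerProductSpace

/-- A nearest point of a convex set to `u` is at least as close to every point of the set as `u`. -/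
theorem norm_sub_le_of_isNearest {F : Type*} [NormedAddCommGroup F] [InnerProductSpace ℝ F]
    {K : Set F} (hK : Convex ℝ K) {u v : F} (hv : v ∈ K)
    (hmin : ∀ w ∈ K, ‖v - u‖ ≤ ‖w - u‖) {w : F} (hw : w ∈ K) : ‖v - w‖ ≤ ‖u - w‖ := by
  have : Nonempty K := ⟨⟨v, hv⟩⟩
  have hinf : ‖u - v‖ = ⨅ w : K, ‖u - w‖ := by
    refine le_antisymm (le_ciInf fun z => ?_)
      (ciInf_le ⟨0, by rintro _ ⟨z, rfl⟩; exact norm_nonneg _⟩ (⟨v, hv⟩ : K))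
    simpa only [norm_sub_rev] using hmin z z.2
  have hobtuse := (norm_eq_iInf_iff_real_inner_le_zero hK hv).1 hinf w hw
  have hexpand := norm_sub_sq_real (u - v) (w - v)
  rw [sub_sub_sub_cancel_right] at hexpand
  rw [norm_sub_rev v w]
  refine le_of_sq_le_sq ?_ (norm_nonneg _)
  nlinarith [sq_nonneg ‖u - v‖]

/-- One step of the projected subgradient method decreases the squared distance to any feasible
point `z` up to an error quadratic in the step-size. -/
theorem projected_subgradient_step {F : Type*} [NormedAddCommGroup F] [InnerProductSpace ℝ F]
    {K : Set F} (hK : Convex ℝ K) {f : F → ℝ} {p q g z : F} {c L : ℝ} (hc : 0 ≤ c)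
    (hg : ‖g‖ ≤ L) (hz : z ∈ K) (hsub : f p + ⟪g, z - p⟫ ≤ f z) (hq : q ∈ K)
    (hmin : ∀ w ∈ K, ‖q - (p - c • g)‖ ≤ ‖w - (p - c • g)‖) :
    2 * c * (f p - f z) ≤ ‖p - z‖ ^ 2 - ‖q - z‖ ^ 2 + c ^ 2 * L ^ 2 := by
  have hle := pow_le_pow_left₀ (norm_nonneg _) (norm_sub_le_of_isNearest hK hq hmin hz) 2
  rw [sub_right_comm, norm_sub_sq_real (p - z), inner_smul_right, norm_smul, mul_pow,
    Real.norm_eq_abs, sq_abs, real_inner_comm] at hle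
  rw [← neg_sub p z, inner_neg_right] at hsub
  have hgL : c ^ 2 * ‖g‖ ^ 2 ≤ c ^ 2 * L ^ 2 := by gcongr
  have hmul : c * (f p - f z) ≤ c * ⟪g, p - z⟫ :=
    mul_le_mul_of_nonneg_left (by linarith) hc
  linarith

theorem stmt5 {n : ℕ} (X : Set (EuclideanSpace ℝ (Fin n)))
    (hXne : X.Nonempty) (hXcl : IsClosed X) (hXcv : Convex ℝ X)
    (R : ℝ) (hR : 0 < R)
    (xstar : EuclideanSpace ℝ (Fin n)) (hxstar : xstar ∈ X)
    (f : EuclideanSpace ℝ (Fin n) → ℝ) (hf : ConvexOn ℝ Set.univ f)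
    (hball : X ⊆ Metric.closedBall xstar R)
    (hmin : ∀ z ∈ X, f xstar ≤ f z)
    (x g : ℕ → EuclideanSpace ℝ (Fin n)) (η : ℕ → ℝ)
    (hx1 : x 1 ∈ X)
    (hηpos : ∀ s, 1 ≤ s → 0 < η s)
    (hsub : ∀ s, 1 ≤ s → ∀ z, f (x s) + ⟪g s, z - x s⟫ ≤ f z)
    (hmem : ∀ s, 1 ≤ s → x (s + 1) ∈ X)
    (hproj : ∀ s, 1 ≤ s → ∀ z ∈ X,
      ‖x (s + 1) - (x s - η s • g s)‖ ≤ ‖z - (x s - η s • g s)‖)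
    (t : ℕ) (ht : 1 ≤ t)
    (L : ℝ) (hL : 0 < L)
    (hLip : ∀ s, 1 ≤ s → s ≤ t → ‖g s‖ ≤ L)
    (hη : ∀ s, 1 ≤ s → s ≤ t → η s = R / (L * Real.sqrt t)) :
    f ((1 / (t : ℝ)) • ∑ s ∈ Finset.Icc 1 t, x s) - f xstar ≤
      R * L / Real.sqrt t := by
  have ht0 : (0 : ℝ) < t := by exact_mod_cast ht
  have hsq : Real.sqrt t ^ 2 = t := Real.sq_sqrt ht0.le
  have hs0 : 0 < Real.sqrt t := Real.sqrt_pos.2 ht0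
  set r := Real.sqrt t
  set c := R / (L * r)
  have hc0 : 0 < c := by positivity
  have hcL : c * (L * r) = R := div_mul_cancel₀ _ (by positivity)
  have hstep : ∀ s ∈ Finset.Icc 1 t, 2 * c * (f (x s) - f xstar) ≤
      ‖x s - xstar‖ ^ 2 - ‖x (s + 1) - xstar‖ ^ 2 + c ^ 2 * L ^ 2 := by
    intro s hs
    obtain ⟨h1, h2⟩ := Finset.mem_Icc.1 hs
    have hnear := hproj s h1
    rw [hη s h1 h2] at hnear
    exact projected_subgradient_step hXcv hc0.le (hLip s h1 h2) hxstar (hsub s h1 xstar)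
      (hmem s h1) hnear
  have htel : ∑ s ∈ Finset.Icc 1 t, (‖x s - xstar‖ ^ 2 - ‖x (s + 1) - xstar‖ ^ 2) =
      ‖x 1 - xstar‖ ^ 2 - ‖x (t + 1) - xstar‖ ^ 2 := by
    rw [← Finset.Ico_add_one_right_eq_Icc, ← neg_inj, ← Finset.sum_neg_distrib]
    simpa only [neg_sub] using Finset.sum_Ico_sub (fun s => ‖x s - xstar‖ ^ 2) (by omega : 1 ≤ t + 1)
  have hsum := Finset.sum_le_sum hstep
  rw [← Finset.mul_sum, Finset.sum_add_distrib, htel, Finset.sum_sub_distrib] at hsum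
  simp only [Finset.sum_const, Nat.card_Icc, Nat.add_sub_cancel, nsmul_eq_mul] at hsum
  have hfirst : ‖x 1 - xstar‖ ^ 2 ≤ R ^ 2 :=
    pow_le_pow_left₀ (norm_nonneg _) (by simpa [dist_eq_norm] using hball hx1) 2
  have hjensen : f ((1 / (t : ℝ)) • ∑ s ∈ Finset.Icc 1 t, x s) ≤
      1 / t * ∑ s ∈ Finset.Icc 1 t, f (x s) := by
    rw [Finset.smul_sum, Finset.mul_sum]
    refine hf.map_sum_le (fun _ _ => by positivity) ?_ fun _ _ => Set.mem_univ _
    simp [ht0.ne']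
  have herr : t * (c ^ 2 * L ^ 2) = R ^ 2 := by rw [← hcL, ← hsq]; ring
  have hregret : ∑ s ∈ Finset.Icc 1 t, f (x s) - t * f xstar ≤ R * (L * r) := by
    refine le_of_mul_le_mul_left ?_ hc0
    have : c * (R * (L * r)) = R ^ 2 := by linear_combination R * hcL
    nlinarith [sq_nonneg ‖x (t + 1) - xstar‖]
  calc f ((1 / (t : ℝ)) • ∑ s ∈ Finset.Icc 1 t, x s) - f xstar
      ≤ 1 / t * ∑ s ∈ Finset.Icc 1 t, f (x s) - f xstar := by gcongr
    _ = (∑ s ∈ Finset.Icc 1 t, f (x s) - t * f xstar) / t := by field_simp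
    _ ≤ R * (L * r) / t := by gcongr
    _ = R * L / r := by rw [← hsq]; field_simp
end

section
/- Let t ≥ 1 and fix a ∈ [0,1]. Run the projected subgradient method with η_s = R/(G_s · s^{a/2}), G_s = max_{1≤j≤s} ‖g_j‖ · j^{(1−a)/2} (each g_s ≠ 0). Then the η-weighted average satisfies f((Σ_{s=1}^t η_s x_s)/(Σ_{s=1}^t η_s)) − f(x*) ≤ [(1 + Σ_{s=1}^t s^{−1}) / (2 Σ_{s=1}^t s^{−1/2})] · R · max_{s=1,…,t} ‖g_s‖. -/
open scoped RealInnerProductSpace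

section ProjectedSubgradient

variable {E : Type*} [NormedAddCommGroup E] [InnerProductSpace ℝ E]

lemma norm_sub_le_of_isProj_convex {K : Set E} (hK : Convex ℝ K) {u v w : E}
    (hv : v ∈ K) (hw : w ∈ K) (hmin : ∀ z ∈ K, ‖v - u‖ ≤ ‖z - u‖) :
    ‖v - w‖ ≤ ‖u - w‖ := by
  have hinf : ‖u - v‖ = ⨅ z : K, ‖u - z‖ := by
    have : Nonempty K := ⟨⟨v, hv⟩⟩
    refine le_antisymm (le_ciInf fun z => ?_)
      (ciInf_le ⟨0, Set.forall_mem_range.2 fun z : K => norm_nonneg (u - z)⟩ (⟨v, hv⟩ : K))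
    simpa only [norm_sub_rev u] using hmin z z.2
  have hinner := (norm_eq_iInf_iff_real_inner_le_zero hK hv).1 hinf w hw
  have hexp : ‖u - w‖ ^ 2 = ‖u - v‖ ^ 2 - 2 * ⟪u - v, w - v⟫ + ‖w - v‖ ^ 2 := by
    rw [← norm_sub_sq_real, sub_sub_sub_cancel_right]
  rw [norm_sub_rev w v] at hexp
  exact le_of_sq_le_sq (by nlinarith [sq_nonneg ‖u - v‖]) (norm_nonneg _)

/-- One step of the projected subgradient method. -/
lemma subgradient_step {K : Set E} (hK : Convex ℝ K) {f : E → ℝ} {x x' g w : E} {c : ℝ}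
    (hc : 0 ≤ c) (hsub : f x + ⟪g, w - x⟫ ≤ f w) (hx' : x' ∈ K) (hw : w ∈ K)
    (hproj : ∀ z ∈ K, ‖x' - (x - c • g)‖ ≤ ‖z - (x - c • g)‖) :
    2 * (c * (f x - f w)) ≤ ‖x - w‖ ^ 2 - ‖x' - w‖ ^ 2 + (c * ‖g‖) ^ 2 := by
  have hle := pow_le_pow_left₀ (norm_nonneg _) (norm_sub_le_of_isProj_convex hK hx' hw hproj) 2
  have hexp : ‖x - c • g - w‖ ^ 2 = ‖x - w‖ ^ 2 + 2 * (c * ⟪g, w - x⟫) + (c * ‖g‖) ^ 2 := by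
    rw [sub_right_comm, norm_sub_sq_real, real_inner_smul_right, norm_smul, Real.norm_of_nonneg hc,
      ← neg_sub w x, inner_neg_left, norm_neg, real_inner_comm]
    ring
  nlinarith [mul_le_mul_of_nonneg_left hsub hc]

/-- The basic inequality of the projected subgradient method. -/
lemma sum_subgradient_gap_le {K : Set E} (hK : Convex ℝ K) {f : E → ℝ} {x g : ℕ → E} {w : E}
    {η : ℕ → ℝ} (hw : w ∈ K) (hη : ∀ s, 1 ≤ s → 0 < η s)
    (hsub : ∀ s, 1 ≤ s → ∀ z, f (x s) + ⟪g s, z - x s⟫ ≤ f z)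
    (hmem : ∀ s, 1 ≤ s → x (s + 1) ∈ K)
    (hproj : ∀ s, 1 ≤ s → ∀ z ∈ K,
      ‖x (s + 1) - (x s - η s • g s)‖ ≤ ‖z - (x s - η s • g s)‖) (t : ℕ) :
    2 * ∑ s ∈ Finset.Icc 1 t, η s * (f (x s) - f w) ≤
      ‖x 1 - w‖ ^ 2 - ‖x (t + 1) - w‖ ^ 2 + ∑ s ∈ Finset.Icc 1 t, (η s * ‖g s‖) ^ 2 := by
  induction t with
  | zero => simp
  | succ k ih =>
    have hk : 1 ≤ k + 1 := by lia
    rw [Finset.sum_Icc_succ_top hk, Finset.sum_Icc_succ_top hk]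
    linarith [subgradient_step hK (hη _ hk).le (hsub _ hk w) (hmem _ hk) hw (hproj _ hk)]

end ProjectedSubgradient

theorem stmt7 {n : ℕ} (X : Set (EuclideanSpace ℝ (Fin n)))
    (hXne : X.Nonempty) (hXcl : IsClosed X) (hXcv : Convex ℝ X)
    (R : ℝ) (hR : 0 < R)
    (xstar : EuclideanSpace ℝ (Fin n)) (hxstar : xstar ∈ X)
    (f : EuclideanSpace ℝ (Fin n) → ℝ) (hf : ConvexOn ℝ Set.univ f)
    (hball : X ⊆ Metric.closedBall xstar R)
    (hmin : ∀ z ∈ X, f xstar ≤ f z)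
    (x g : ℕ → EuclideanSpace ℝ (Fin n)) (η : ℕ → ℝ)
    (hx1 : x 1 ∈ X)
    (hηpos : ∀ s, 1 ≤ s → 0 < η s)
    (hsub : ∀ s, 1 ≤ s → ∀ z, f (x s) + ⟪g s, z - x s⟫ ≤ f z)
    (hmem : ∀ s, 1 ≤ s → x (s + 1) ∈ X)
    (hproj : ∀ s, 1 ≤ s → ∀ z ∈ X,
      ‖x (s + 1) - (x s - η s • g s)‖ ≤ ‖z - (x s - η s • g s)‖)
    (a : ℝ) (ha : a ∈ Set.Icc (0 : ℝ) 1)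
    (t : ℕ) (ht : 1 ≤ t)
    (hgne : ∀ s, 1 ≤ s → s ≤ t → g s ≠ 0)
    (G : ℕ → ℝ)
    (hG : ∀ s (hs : 1 ≤ s), G s =
      (Finset.Icc 1 s).sup' (Finset.nonempty_Icc.mpr hs)
        (fun j => ‖g j‖ * (j : ℝ) ^ ((1 - a) / 2)))
    (hη : ∀ s, 1 ≤ s → s ≤ t → η s = R / (G s * (s : ℝ) ^ (a / 2)))
    :
    f ((∑ s ∈ Finset.Icc 1 t, η s)⁻¹ • ∑ s ∈ Finset.Icc 1 t, η s • x s) - f xstar ≤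
      (1 + ∑ s ∈ Finset.Icc 1 t, ((s : ℝ))⁻¹) /
          (2 * ∑ s ∈ Finset.Icc 1 t, (s : ℝ) ^ (-(1 : ℝ) / 2)) *
        (R * ((Finset.Icc 1 t).sup' (Finset.nonempty_Icc.mpr ht) fun s => ‖g s‖)) := by
  set M := (Finset.Icc 1 t).sup' (Finset.nonempty_Icc.mpr ht) fun s => ‖g s‖ with hM
  set S := ∑ s ∈ Finset.Icc 1 t, (s : ℝ) ^ (-(1 : ℝ) / 2) with hS
  have hgM : ∀ s ∈ Finset.Icc 1 t, ‖g s‖ ≤ M := fun s hs =>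
    Finset.le_sup' (fun s => ‖g s‖) hs
  have hMpos : 0 < M :=
    (norm_pos_iff.2 (hgne 1 le_rfl ht)).trans_le (hgM 1 (Finset.mem_Icc.2 ⟨le_rfl, ht⟩))
  have hspos : ∀ s ∈ Finset.Icc 1 t, (0 : ℝ) < s := fun s hs => by
    exact_mod_cast (Finset.mem_Icc.1 hs).1
  have hne := Finset.nonempty_Icc.mpr ht
  have hSpos : 0 < S := Finset.sum_pos (fun s hs => Real.rpow_pos_of_pos (hspos s hs) _) hne
  have hηsum : 0 < ∑ s ∈ Finset.Icc 1 t, η s :=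
    Finset.sum_pos (fun s hs => hηpos s (Finset.mem_Icc.1 hs).1) hne
  have hpow : ∀ s ∈ Finset.Icc 1 t,
      (s : ℝ) ^ ((1 - a) / 2) * (s : ℝ) ^ (a / 2) = (s : ℝ) ^ (1 / 2 : ℝ) := fun s hs => by
    rw [← Real.rpow_add (hspos s hs)]
    ring_nf
  have hη_upper : ∀ s ∈ Finset.Icc 1 t, (η s * ‖g s‖) ^ 2 ≤ R ^ 2 * (s : ℝ)⁻¹ := fun s hs => by
    obtain ⟨h1, h2⟩ := Finset.mem_Icc.1 hs
    have h0 := hspos s hs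
    have hg : 0 < ‖g s‖ := norm_pos_iff.2 (hgne s h1 h2)
    have hGge : ‖g s‖ * (s : ℝ) ^ ((1 - a) / 2) ≤ G s := by
      rw [hG s h1]
      exact Finset.le_sup' (fun j : ℕ => ‖g j‖ * (j : ℝ) ^ ((1 - a) / 2))
        (Finset.mem_Icc.2 ⟨h1, le_rfl⟩)
    have hden : ‖g s‖ * (s : ℝ) ^ (1 / 2 : ℝ) ≤ G s * (s : ℝ) ^ (a / 2) := by
      rw [← hpow s hs, ← mul_assoc]
      gcongr
    have hle : η s * ‖g s‖ ≤ R / (s : ℝ) ^ (1 / 2 : ℝ) := by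
      rw [hη s h1 h2]
      calc R / (G s * (s : ℝ) ^ (a / 2)) * ‖g s‖
          ≤ R / (‖g s‖ * (s : ℝ) ^ (1 / 2 : ℝ)) * ‖g s‖ := by gcongr
        _ = R / (s : ℝ) ^ (1 / 2 : ℝ) := by field_simp
    calc (η s * ‖g s‖) ^ 2 ≤ (R / (s : ℝ) ^ (1 / 2 : ℝ)) ^ 2 :=
          pow_le_pow_left₀ (mul_nonneg (hηpos s h1).le hg.le) hle 2
      _ = R ^ 2 * (s : ℝ)⁻¹ := by
          rw [div_pow, ← Real.sqrt_eq_rpow, Real.sq_sqrt h0.le, div_eq_mul_inv]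
  have hη_lower : R / M * S ≤ ∑ s ∈ Finset.Icc 1 t, η s := by
    rw [hS, Finset.mul_sum]
    refine Finset.sum_le_sum fun s hs => ?_
    obtain ⟨h1, h2⟩ := Finset.mem_Icc.1 hs
    have h0 := hspos s hs
    have hGle : G s ≤ M * (s : ℝ) ^ ((1 - a) / 2) := by
      rw [hG s h1]
      refine Finset.sup'_le _ _ fun j hj => ?_
      obtain ⟨hj1, hj2⟩ := Finset.mem_Icc.1 hj
      have hexp : 0 ≤ (1 - a) / 2 := by linarith [ha.2]
      have := hgM j (Finset.mem_Icc.2 ⟨hj1, hj2.trans h2⟩)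
      gcongr
    have hGpos : 0 < G s * (s : ℝ) ^ (a / 2) := by
      have := hηpos s h1
      rw [hη s h1 h2] at this
      exact (div_pos_iff_of_pos_left hR).1 this
    have hden : G s * (s : ℝ) ^ (a / 2) ≤ M * (s : ℝ) ^ (1 / 2 : ℝ) := by
      rw [← hpow s hs, ← mul_assoc]
      gcongr
    calc R / M * (s : ℝ) ^ (-(1 : ℝ) / 2) = R / (M * (s : ℝ) ^ (1 / 2 : ℝ)) := by
          rw [neg_div, Real.rpow_neg h0.le]
          field_simp
      _ ≤ η s := by
          rw [hη s h1 h2]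
          gcongr
  have hgap : ∑ s ∈ Finset.Icc 1 t, η s * (f (x s) - f xstar) ≤
      R ^ 2 * (1 + ∑ s ∈ Finset.Icc 1 t, ((s : ℝ))⁻¹) / 2 := by
    have hbasic := sum_subgradient_gap_le hXcv hxstar hηpos hsub hmem hproj t
    have hdist : ‖x 1 - xstar‖ ^ 2 ≤ R ^ 2 :=
      pow_le_pow_left₀ (norm_nonneg _) (mem_closedBall_iff_norm.1 (hball hx1)) 2
    have hsum := Finset.sum_le_sum hη_upper
    rw [← Finset.mul_sum] at hsum
    linarith [sq_nonneg ‖x (t + 1) - xstar‖]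
  have hjensen : f ((∑ s ∈ Finset.Icc 1 t, η s)⁻¹ • ∑ s ∈ Finset.Icc 1 t, η s • x s) - f xstar ≤
      (∑ s ∈ Finset.Icc 1 t, η s * (f (x s) - f xstar)) / ∑ s ∈ Finset.Icc 1 t, η s := by
    have h := hf.map_centerMass_le (t := Finset.Icc 1 t) (w := η) (p := x)
      (fun s hs => (hηpos s (Finset.mem_Icc.1 hs).1).le) hηsum (fun _ _ => Set.mem_univ _)
    simp only [Finset.centerMass, smul_eq_mul, Function.comp_apply] at h
    have hsplit : (∑ s ∈ Finset.Icc 1 t, η s * (f (x s) - f xstar)) / ∑ s ∈ Finset.Icc 1 t, η s =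
        (∑ s ∈ Finset.Icc 1 t, η s)⁻¹ * ∑ s ∈ Finset.Icc 1 t, η s * f (x s) - f xstar := by
      simp only [mul_sub, Finset.sum_sub_distrib, ← Finset.sum_mul]
      field_simp
    linarith
  have hH : 0 ≤ ∑ s ∈ Finset.Icc 1 t, ((s : ℝ))⁻¹ :=
    Finset.sum_nonneg fun s _ => by positivity
  calc _ ≤ _ := hjensen
    _ ≤ (R ^ 2 * (1 + ∑ s ∈ Finset.Icc 1 t, ((s : ℝ))⁻¹) / 2) / ∑ s ∈ Finset.Icc 1 t, η s := by
        gcongr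
    _ ≤ (R ^ 2 * (1 + ∑ s ∈ Finset.Icc 1 t, ((s : ℝ))⁻¹) / 2) / (R / M * S) := by gcongr
    _ = _ := by field_simp
end

section
/- Let t ≥ 1, fix −1 ≤ k ≤ 0 and let g_1,…,g_t be nonzero vectors with M = max_{s=1,…,t} ‖g_s‖. Fix a ∈ [0,1], let G_s = max_{1≤j≤s} ‖g_j‖ · j^{(1−a)/2} and η_s = R/(G_s · s^{a/2}) with R > 0. Then [(R²/(2η_t^{k+1})) + Σ_{s=1}^t (η_s^{1−k}/2)·‖g_s‖²] / (Σ_{s=1}^t η_s^{−k}) ≤ [(t^{(k+1)/2} + Σ_{s=1}^t s^{(k−1)/2}) / (2 Σ_{s=1}^t s^{k/2})] · R · M. -/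
/-- Expands a real power of the step size `R / (M * √s)`. -/
theorem div_mul_sqrt_rpow {R M s : ℝ} (hR : 0 < R) (hM : 0 < M) (hs : 0 < s) (e : ℝ) :
    (R / (M * s ^ (1 / 2 : ℝ))) ^ e = R ^ e * M ^ (-e) * s ^ (-e / 2) := by
  have hs' : 0 < s ^ (1 / 2 : ℝ) := Real.rpow_pos_of_pos hs _
  rw [Real.div_rpow hR.le (by positivity), Real.mul_rpow hM.le hs'.le, ← Real.rpow_mul hs.le,
    Real.rpow_neg hM.le, show -e / 2 = -(1 / 2 * e) by ring, Real.rpow_neg hs.le]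
  field_simp

/-- If the step size `η` satisfies `x * √s ≤ R / η ≤ M * √s` then a single summand of the
telescoping bound is controlled by its value at `R / (M * √s)`. -/
theorem rpow_div_two_mul_sq_le {R M s k η x : ℝ} (hR : 0 < R) (hM : 0 < M) (hs : 0 < s)
    (hη : 0 < η) (hx : 0 ≤ x) (hk : -1 ≤ k) (hle : R / (M * s ^ (1 / 2 : ℝ)) ≤ η)
    (hxη : η * (x * s ^ (1 / 2 : ℝ)) ≤ R) :
    η ^ (1 - k) / 2 * x ^ 2 ≤ R ^ (1 - k) * M ^ (k + 1) / 2 * s ^ ((k - 1) / 2) := by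
  have hs' : 0 < s ^ (1 / 2 : ℝ) := Real.rpow_pos_of_pos hs _
  have hsq : (s ^ (1 / 2 : ℝ)) ^ 2 = s := by
    rw [← Real.rpow_natCast, ← Real.rpow_mul hs.le]; norm_num
  have hpow : η ^ (-(k + 1)) ≤ R ^ (-(k + 1)) * M ^ (k + 1) * s ^ ((k + 1) / 2) := by
    have h := Real.rpow_le_rpow_of_nonpos (by positivity) hle (by linarith : -(k + 1) ≤ 0)
    rwa [div_mul_sqrt_rpow hR hM hs, neg_neg] at h
  have hsplit : ∀ y : ℝ, 0 < y → y ^ (1 - k) = y ^ 2 * y ^ (-(k + 1)) := fun y hy => by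
    rw [← Real.rpow_natCast, ← Real.rpow_add hy]; congr 1; push_cast; ring
  have hdiv : s ^ ((k - 1) / 2) = s ^ ((k + 1) / 2) / s := by
    rw [← Real.rpow_sub_one hs.ne']; congr 1; ring
  have hsqle : (η * x) ^ 2 ≤ R ^ 2 / s := by
    rw [le_div_iff₀ hs]
    calc (η * x) ^ 2 * s = (η * (x * s ^ (1 / 2 : ℝ))) ^ 2 := by
          rw [← mul_assoc, mul_pow _ (s ^ _), hsq]
      _ ≤ R ^ 2 := by gcongr
  calc η ^ (1 - k) / 2 * x ^ 2 = (η * x) ^ 2 * η ^ (-(k + 1)) / 2 := by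
        rw [hsplit η hη]; ring
    _ ≤ R ^ 2 / s * (R ^ (-(k + 1)) * M ^ (k + 1) * s ^ ((k + 1) / 2)) / 2 := by gcongr
    _ = _ := by rw [hsplit R hR, hdiv]; ring

theorem stmt16 {n : ℕ} (t : ℕ) (ht : 1 ≤ t) (k a R : ℝ)
    (hk : -1 ≤ k) (hk0 : k ≤ 0) (ha : a ∈ Set.Icc (0 : ℝ) 1) (hR : 0 < R)
    (g : ℕ → EuclideanSpace ℝ (Fin n)) (hgne : ∀ s, 1 ≤ s → s ≤ t → g s ≠ 0)
    (G η : ℕ → ℝ)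
    (hG : ∀ s (hs : 1 ≤ s), G s =
      (Finset.Icc 1 s).sup' (Finset.nonempty_Icc.mpr hs)
        (fun j => ‖g j‖ * (j : ℝ) ^ ((1 - a) / 2)))
    (hη : ∀ s, 1 ≤ s → η s = R / (G s * (s : ℝ) ^ (a / 2))) :
    (R ^ 2 / (2 * η t ^ (k + 1)) +
        ∑ s ∈ Finset.Icc 1 t, η s ^ (1 - k) / 2 * ‖g s‖ ^ 2) /
        (∑ s ∈ Finset.Icc 1 t, η s ^ (-k)) ≤
      ((t : ℝ) ^ ((k + 1) / 2) + ∑ s ∈ Finset.Icc 1 t, (s : ℝ) ^ ((k - 1) / 2)) /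
          (2 * ∑ s ∈ Finset.Icc 1 t, (s : ℝ) ^ (k / 2)) *
        (R * ((Finset.Icc 1 t).sup' (Finset.nonempty_Icc.mpr ht) fun s => ‖g s‖)) := by
  set M := (Finset.Icc 1 t).sup' (Finset.nonempty_Icc.mpr ht) fun s => ‖g s‖
  have hgM : ∀ s, 1 ≤ s → s ≤ t → ‖g s‖ ≤ M := fun s h1 h2 =>
    Finset.le_sup' (fun s => ‖g s‖) (Finset.mem_Icc.mpr ⟨h1, h2⟩)
  have hM : 0 < M := (norm_pos_iff.mpr (hgne 1 le_rfl ht)).trans_le (hgM 1 le_rfl ht)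
  have hcast : ∀ s : ℕ, 1 ≤ s → (0 : ℝ) < s := fun s h => by exact_mod_cast h
  have hcomb : ∀ s : ℕ, 1 ≤ s →
      (s : ℝ) ^ ((1 - a) / 2) * (s : ℝ) ^ (a / 2) = (s : ℝ) ^ (1 / 2 : ℝ) := fun s h => by
    rw [← Real.rpow_add (hcast s h)]; congr 1; ring
  have hGge : ∀ s, 1 ≤ s → ‖g s‖ * (s : ℝ) ^ ((1 - a) / 2) ≤ G s := fun s h => by
    rw [hG s h]
    exact Finset.le_sup' (fun j : ℕ => ‖g j‖ * (j : ℝ) ^ ((1 - a) / 2))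
      (Finset.mem_Icc.mpr ⟨h, le_rfl⟩)
  have hGle : ∀ s, 1 ≤ s → s ≤ t → G s ≤ M * (s : ℝ) ^ ((1 - a) / 2) := fun s h1 h2 => by
    rw [hG s h1]
    refine Finset.sup'_le _ _ fun j hj => ?_
    obtain ⟨hj1, hj2⟩ := Finset.mem_Icc.mp hj
    have := hgM j hj1 (hj2.trans h2)
    have : (0 : ℝ) ≤ (1 - a) / 2 := by linarith [ha.2]
    gcongr
  have hGpos : ∀ s, 1 ≤ s → s ≤ t → 0 < G s := fun s h1 h2 =>
    (mul_pos (norm_pos_iff.mpr (hgne s h1 h2)) (Real.rpow_pos_of_pos (hcast s h1) _)).trans_le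
      (hGge s h1)
  have hηpos : ∀ s, 1 ≤ s → s ≤ t → 0 < η s := fun s h1 h2 => by
    rw [hη s h1]
    exact div_pos hR (mul_pos (hGpos s h1 h2) (Real.rpow_pos_of_pos (hcast s h1) _))
  have hηge : ∀ s, 1 ≤ s → s ≤ t → R / (M * (s : ℝ) ^ (1 / 2 : ℝ)) ≤ η s := fun s h1 h2 => by
    have hp := Real.rpow_pos_of_pos (hcast s h1) (a / 2)
    have hGs := hGpos s h1 h2
    rw [hη s h1, ← hcomb s h1, ← mul_assoc]
    have := hGle s h1 h2
    gcongr
  have hηg : ∀ s, 1 ≤ s → s ≤ t → η s * (‖g s‖ * (s : ℝ) ^ (1 / 2 : ℝ)) ≤ R := fun s h1 h2 => by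
    have hp := Real.rpow_pos_of_pos (hcast s h1) (a / 2)
    have hGs := hGpos s h1 h2
    rw [hη s h1, ← hcomb s h1, ← mul_assoc ‖g s‖, div_mul_eq_mul_div, div_le_iff₀ (by positivity)]
    have := hGge s h1
    gcongr
  have hlast : R ^ 2 / (2 * η t ^ (k + 1)) ≤
      R ^ (1 - k) * M ^ (k + 1) / 2 * (t : ℝ) ^ ((k + 1) / 2) := by
    have h := Real.rpow_le_rpow_of_nonpos (by have := hcast t ht; positivity) (hηge t ht le_rfl)
      (by linarith : -(k + 1) ≤ 0)
    rw [div_mul_sqrt_rpow hR hM (hcast t ht), neg_neg, Real.rpow_neg (hηpos t ht le_rfl).le] at h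
    have hsplit : R ^ (1 - k) = R ^ 2 * R ^ (-(k + 1)) := by
      rw [← Real.rpow_natCast, ← Real.rpow_add hR]; congr 1; push_cast; ring
    calc R ^ 2 / (2 * η t ^ (k + 1)) = R ^ 2 / 2 * (η t ^ (k + 1))⁻¹ := by
          rw [← div_div]; rfl
      _ ≤ R ^ 2 / 2 * (R ^ (-(k + 1)) * M ^ (k + 1) * (t : ℝ) ^ ((k + 1) / 2)) := by gcongr
      _ = _ := by rw [hsplit]; ring
  have hsum : ∑ s ∈ Finset.Icc 1 t, η s ^ (1 - k) / 2 * ‖g s‖ ^ 2 ≤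
      R ^ (1 - k) * M ^ (k + 1) / 2 * ∑ s ∈ Finset.Icc 1 t, (s : ℝ) ^ ((k - 1) / 2) := by
    rw [Finset.mul_sum]
    refine Finset.sum_le_sum fun s hs => ?_
    obtain ⟨h1, h2⟩ := Finset.mem_Icc.mp hs
    exact rpow_div_two_mul_sq_le hR hM (hcast s h1) (hηpos s h1 h2) (norm_nonneg _) hk
      (hηge s h1 h2) (hηg s h1 h2)
  have hden : R ^ (-k) * M ^ k * ∑ s ∈ Finset.Icc 1 t, (s : ℝ) ^ (k / 2) ≤
      ∑ s ∈ Finset.Icc 1 t, η s ^ (-k) := by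
    rw [Finset.mul_sum]
    refine Finset.sum_le_sum fun s hs => ?_
    obtain ⟨h1, h2⟩ := Finset.mem_Icc.mp hs
    have h := Real.rpow_le_rpow (by have := hcast s h1; positivity) (hηge s h1 h2)
      (by linarith : 0 ≤ -k)
    rwa [div_mul_sqrt_rpow hR hM (hcast s h1), neg_neg] at h
  have hP : 0 < ∑ s ∈ Finset.Icc 1 t, (s : ℝ) ^ (k / 2) :=
    Finset.sum_pos (fun s hs => Real.rpow_pos_of_pos (hcast s (Finset.mem_Icc.mp hs).1) _)
      (Finset.nonempty_Icc.mpr ht)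
  have hRk : R ^ (1 - k) = R * R ^ (-k) := by
    rw [sub_eq_add_neg, Real.rpow_add hR, Real.rpow_one]
  have hMk : M ^ (k + 1) = M ^ k * M := Real.rpow_add_one hM.ne' k
  have hRpos : 0 < R ^ (-k) := Real.rpow_pos_of_pos hR _
  have hMpos : 0 < M ^ k := Real.rpow_pos_of_pos hM _
  refine (div_le_div₀ ?_ (add_le_add hlast hsum) (by positivity) hden).trans_eq ?_
  · positivity
  · rw [hRk, hMk]
    field_simp
end

section
/- Let t ≥ 1, fix k > 0 and let g_1,…,g_t be nonzero vectors with M = max_{s=1,…,t} ‖g_s‖. Fix a ∈ [0,1], let G_s = max_{1≤j≤s} ‖g_j‖ · j^{(1−a)/2} and η_s = R/(G_s · s^{a/2}) with R > 0. Then [(R² t^{k/2}/(2η_t)) + Σ_{s=1}^t (s^{k/2} η_s/2)·‖g_s‖²] / (Σ_{s=1}^t s^{k/2}) ≤ [(t^{(k+1)/2} + Σ_{s=1}^t s^{(k−1)/2}) / (2 Σ_{s=1}^t s^{k/2})] · R · M. -/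
theorem rpow_half_eq_mul {x : ℝ} (a : ℝ) (hx : 0 < x) :
    x ^ ((1 : ℝ) / 2) = x ^ ((1 - a) / 2) * x ^ (a / 2) := by
  rw [← Real.rpow_add hx]
  ring_nf

theorem stmt17 {n : ℕ} (t : ℕ) (ht : 1 ≤ t) (k a R : ℝ)
    (hk : 0 < k) (ha : a ∈ Set.Icc (0 : ℝ) 1) (hR : 0 < R)
    (g : ℕ → EuclideanSpace ℝ (Fin n)) (hgne : ∀ s, 1 ≤ s → s ≤ t → g s ≠ 0)
    (G η : ℕ → ℝ)
    (hG : ∀ s (hs : 1 ≤ s), G s =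
      (Finset.Icc 1 s).sup' (Finset.nonempty_Icc.mpr hs)
        (fun j => ‖g j‖ * (j : ℝ) ^ ((1 - a) / 2)))
    (hη : ∀ s, 1 ≤ s → η s = R / (G s * (s : ℝ) ^ (a / 2))) :
    (R ^ 2 * (t : ℝ) ^ (k / 2) / (2 * η t) +
        ∑ s ∈ Finset.Icc 1 t, (s : ℝ) ^ (k / 2) * η s / 2 * ‖g s‖ ^ 2) /
        (∑ s ∈ Finset.Icc 1 t, (s : ℝ) ^ (k / 2)) ≤
      ((t : ℝ) ^ ((k + 1) / 2) + ∑ s ∈ Finset.Icc 1 t, (s : ℝ) ^ ((k - 1) / 2)) /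
          (2 * ∑ s ∈ Finset.Icc 1 t, (s : ℝ) ^ (k / 2)) *
        (R * ((Finset.Icc 1 t).sup' (Finset.nonempty_Icc.mpr ht) fun s => ‖g s‖)) := by
  set M := (Finset.Icc 1 t).sup' (Finset.nonempty_Icc.mpr ht) fun s => ‖g s‖ with hM
  have hgM : ∀ s ∈ Finset.Icc 1 t, ‖g s‖ ≤ M := fun s hs =>
    Finset.le_sup' (fun s => ‖g s‖) hs
  have hlow : ∀ s, 1 ≤ s → ‖g s‖ * (s : ℝ) ^ ((1 : ℝ) / 2) ≤ G s * (s : ℝ) ^ (a / 2) := by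
    intro s hs
    have hs0 : (0 : ℝ) < s := by exact_mod_cast hs
    have hle : ‖g s‖ * (s : ℝ) ^ ((1 - a) / 2) ≤ G s := by
      rw [hG s hs]
      exact Finset.le_sup' (fun j : ℕ => ‖g j‖ * (j : ℝ) ^ ((1 - a) / 2))
        (Finset.mem_Icc.mpr ⟨hs, le_rfl⟩)
    rw [rpow_half_eq_mul a hs0, ← mul_assoc]
    gcongr
  have hup : G t * (t : ℝ) ^ (a / 2) ≤ M * (t : ℝ) ^ ((1 : ℝ) / 2) := by
    have ht0 : (0 : ℝ) < t := by exact_mod_cast ht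
    have hle : G t ≤ M * (t : ℝ) ^ ((1 - a) / 2) := by
      rw [hG t ht]
      refine Finset.sup'_le _ _ fun j hj => ?_
      refine mul_le_mul (hgM j hj) ?_ (by positivity) ((norm_nonneg _).trans (hgM j hj))
      exact Real.rpow_le_rpow (by positivity) (by exact_mod_cast (Finset.mem_Icc.mp hj).2)
        (by linarith [ha.2])
    rw [rpow_half_eq_mul a ht0, ← mul_assoc]
    gcongr
  have hlast : R ^ 2 * (t : ℝ) ^ (k / 2) / (2 * η t) ≤ (t : ℝ) ^ ((k + 1) / 2) * (R * M) / 2 := by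
    have ht0 : (0 : ℝ) < t := by exact_mod_cast ht
    have hsplit : (t : ℝ) ^ ((k + 1) / 2) = (t : ℝ) ^ (k / 2) * (t : ℝ) ^ ((1 : ℝ) / 2) := by
      rw [← Real.rpow_add ht0, add_div]
    calc R ^ 2 * (t : ℝ) ^ (k / 2) / (2 * η t)
        = R * (t : ℝ) ^ (k / 2) / 2 * (G t * (t : ℝ) ^ (a / 2)) := by
          rw [hη t ht]
          field_simp
      _ ≤ R * (t : ℝ) ^ (k / 2) / 2 * (M * (t : ℝ) ^ ((1 : ℝ) / 2)) := by gcongr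
      _ = (t : ℝ) ^ ((k + 1) / 2) * (R * M) / 2 := by rw [hsplit]; ring
  have hterm : ∀ s ∈ Finset.Icc 1 t, (s : ℝ) ^ (k / 2) * η s / 2 * ‖g s‖ ^ 2 ≤
      (s : ℝ) ^ ((k - 1) / 2) * (R * M / 2) := by
    intro s hs
    obtain ⟨hs1, hst⟩ := Finset.mem_Icc.mp hs
    have hs0 : (0 : ℝ) < s := by exact_mod_cast hs1
    have hgs : 0 < ‖g s‖ := norm_pos_iff.mpr (hgne s hs1 hst)
    have hsplit : (s : ℝ) ^ (k / 2) = (s : ℝ) ^ ((k - 1) / 2) * (s : ℝ) ^ ((1 : ℝ) / 2) := by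
      rw [← Real.rpow_add hs0]
      ring_nf
    calc (s : ℝ) ^ (k / 2) * η s / 2 * ‖g s‖ ^ 2
        ≤ (s : ℝ) ^ (k / 2) * (R / (‖g s‖ * (s : ℝ) ^ ((1 : ℝ) / 2))) / 2 * ‖g s‖ ^ 2 := by
          rw [hη s hs1]
          have hstep := div_le_div_of_nonneg_left hR.le (by positivity) (hlow s hs1)
          gcongr ?_ * ?_ / 2 * _
      _ = (s : ℝ) ^ ((k - 1) / 2) * (R * ‖g s‖ / 2) := by
          rw [hsplit]
          field_simp
      _ ≤ (s : ℝ) ^ ((k - 1) / 2) * (R * M / 2) := by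
          gcongr
          exact hgM s hs
  have hsum := Finset.sum_le_sum hterm
  rw [← Finset.sum_mul] at hsum
  have hweight : 0 < ∑ s ∈ Finset.Icc 1 t, (s : ℝ) ^ (k / 2) :=
    Finset.sum_pos (fun s hs => Real.rpow_pos_of_pos
      (by exact_mod_cast (Finset.mem_Icc.mp hs).1) _) (Finset.nonempty_Icc.mpr ht)
  rw [div_mul_eq_mul_div, div_le_div_iff₀ hweight (by positivity)]
  nlinarith [mul_le_mul_of_nonneg_right (add_le_add hlast hsum) hweight.le]
end
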